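/- arXiv:1709.04645 — 2 statements merged into one kernel-verified Lean document; each statement's English description precedes it below -/
import Mathlib

section
/- Let G be a 3-connected simple graph and X an edge set of G such that G[X] has precisely two connected components, and let e ∈ E(G)∖X be essential. Then one of the following holds: (1) e joins the two components of G[X]; or (2) there is a component C of G[X] consisting of a single edge, e has an endvertex v of degree three incident with that edge, and the third edge incident with v joins the two components of G[X]; or (3) there is a component C of G[X] consisting of precisely two edges which form a triangle together with e, both endvertices of e have degree three, and each endvertex of e is incident with an edge joining the two components of G[X]. -/
open SimpleGraph

/-- An edge set `X` is connected: any two vertices covered by `X` are joined by a path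
consisting of edges of `X`.  (The empty edge set counts as connected.) -/
def EdgeSetConnected {V : Type*} (X : Set (Sym2 V)) : Prop :=
  ∀ u ∈ (fromEdgeSet X).support, ∀ v ∈ (fromEdgeSet X).support, (fromEdgeSet X).Reachable u v

/-- The subgraph `G[X]` spanned by an edge set `X`, as a graph on the covered vertices. -/
def edgeSubgraph {V : Type*} (X : Set (Sym2 V)) :
    SimpleGraph ((fromEdgeSet X).support) :=
  (fromEdgeSet X).induce (fromEdgeSet X).support

/-- The number of connected components of `G[X]`. -/
noncomputable def edgeComponents {V : Type*} (X : Set (Sym2 V)) : ℕ :=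
  Nat.card (edgeSubgraph X).ConnectedComponent

/-- A graph is `k`-connected if it has more than `k` vertices and deleting fewer than `k`
vertices always leaves a connected graph. -/
def KConnected {V : Type*} (k : ℕ) (G : SimpleGraph V) : Prop :=
  k < Nat.card V ∧ ∀ S : Set V, S.ncard < k → (G.induce Sᶜ).Connected

/-- A constraint graph: a finite simple graph `G` together with a set `X` of edges. -/
structure CGraph : Type 1 where
  V : Type
  G : SimpleGraph V
  X : Set (Sym2 V)
  fin : Finite V := by infer_instance

attribute [instance] CGraph.fin

/-- `X` really is a set of edges of `G`. -/
def CGraph.WF (C : CGraph) : Prop := C.X ⊆ C.G.edgeSet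

/-- The vertex map contracting `v` onto `u`. -/
noncomputable def contractFun {V : Type*} {u v : V} (huv : u ≠ v) (x : V) : {w : V // w ≠ v} :=
  letI := Classical.decEq V
  if h : x = v then ⟨u, huv⟩ else ⟨x, h⟩

/-- Contraction of a simple graph, identifying `v` with `u` (loops are discarded, parallel
edges are merged, so the result is simple). -/
noncomputable def contractGraph {V : Type*} (G : SimpleGraph V) {u v : V} (huv : u ≠ v) :
    SimpleGraph {w : V // w ≠ v} :=
  fromEdgeSet (Sym2.map (contractFun huv) '' G.edgeSet)

/-- Contraction of a constraint graph: identify `v` with `u`; the new constraint consists of all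
non-loop images of constraint edges; thus in each parallel class edges of `X` are preferred. -/
noncomputable def CGraph.contract (C : CGraph) (u v : C.V) (huv : u ≠ v) : CGraph where
  V := {w : C.V // w ≠ v}
  G := contractGraph C.G huv
  X := {e | e ∈ Sym2.map (contractFun huv) '' C.X ∧ ¬ e.IsDiag}

/-- Deletion of an edge from a constraint graph. -/
def CGraph.deleteEdge (C : CGraph) (e : Sym2 C.V) : CGraph where
  V := C.V
  G := C.G.deleteEdges {e}
  X := C.X

/-- One step in forming a constraint minor: delete an edge not in `X`, or contract an edge. -/
inductive CMinorStep : CGraph → CGraph → Prop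
  | del (C : CGraph) (e : Sym2 C.V) (he : e ∈ C.G.edgeSet) (hx : e ∉ C.X) :
      CMinorStep C (C.deleteEdge e)
  | contr (C : CGraph) (u v : C.V) (h : C.G.Adj u v) :
      CMinorStep C (C.contract u v h.ne)

/-- The constraint-minor relation. -/
def IsCMinor : CGraph → CGraph → Prop := Relation.ReflTransGen CMinorStep

/-- Isomorphism of constraint graphs. -/
def CGIso (C D : CGraph) : Prop :=
  ∃ φ : C.G ≃g D.G, Sym2.map (⇑φ) '' C.X = D.X

/-- The constraint `K₄`. -/
def constraintK4 : CGraph where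
  V := Fin 4
  G := ⊤
  X := {s(0, 1), s(2, 3)}

def wheelGraph : SimpleGraph (Fin 5) :=
  fromEdgeSet {s(0, 1), s(1, 2), s(2, 3), s(3, 0), s(0, 4), s(1, 4), s(2, 4), s(3, 4)}

/-- The constraint wheel. -/
def constraintWheel : CGraph where
  V := Fin 5
  G := wheelGraph
  X := {s(0, 1), s(2, 3)}

/-- The prism `K₃ □ K₂`, with triangles `{0,1,2}` and `{3,4,5}`. -/
def prismGraph : SimpleGraph (Fin 6) :=
  fromEdgeSet {s(0, 1), s(1, 2), s(0, 2), s(3, 4), s(4, 5), s(3, 5), s(0, 3), s(1, 4), s(2, 5)}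

def topEdges : Set (Sym2 (Fin 6)) := {s(0, 1), s(1, 2), s(0, 2)}
def botEdges : Set (Sym2 (Fin 6)) := {s(3, 4), s(4, 5), s(3, 5)}

/-- Constraint sets of the four constraint prisms: contained in the two triangles and meeting
every vertex, inducing a spanning connected subgraph of each triangle. -/
def PrismConstraintSet (X : Set (Sym2 (Fin 6))) : Prop :=
  X ⊆ topEdges ∪ botEdges ∧
  EdgeSetConnected (X ∩ topEdges) ∧ (fromEdgeSet (X ∩ topEdges)).support = {0, 1, 2} ∧
  EdgeSetConnected (X ∩ botEdges) ∧ (fromEdgeSet (X ∩ botEdges)).support = {3, 4, 5}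

/-- `C` is one of the four constraint prisms. -/
def IsConstraintPrism (C : CGraph) : Prop :=
  ∃ X, PrismConstraintSet X ∧ CGIso C (CGraph.mk (Fin 6) prismGraph X)

/-- The six obstructions. -/
def IsObstruction (D : CGraph) : Prop :=
  CGIso D constraintK4 ∨ CGIso D constraintWheel ∨ IsConstraintPrism D

/-- The weird prism. -/
def weirdPrism : CGraph where
  V := Fin 6
  G := prismGraph
  X := {s(0, 3), s(1, 4), s(2, 5)}

/-- The Wagner graph `V₈`. -/
def wagnerGraph : SimpleGraph (Fin 8) :=
  fromEdgeSet {s(0, 1), s(1, 2), s(2, 3), s(3, 4), s(4, 5), s(5, 6), s(6, 7), s(7, 0),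
    s(0, 4), s(1, 5), s(2, 6), s(3, 7)}

/-- The constraint Wagner graph: `X` is the complement of the 6-cycle `0-1-5-4-3-7-0`. -/
def constraintWagner : CGraph where
  V := Fin 8
  G := wagnerGraph
  X := {s(1, 2), s(2, 3), s(5, 6), s(6, 7), s(0, 4), s(2, 6)}

/-- The Wagner prism. -/
def wagnerPrism : CGraph where
  V := Fin 6
  G := prismGraph
  X := {s(0, 3), s(1, 2), s(4, 5)}

/-- `(G, X)` has a 3-connected constraint minor whose constraint is disconnected. -/
def BadMinor (C : CGraph) : Prop :=
  ∃ C', IsCMinor C C' ∧ KConnected 3 C'.G ∧ ¬ EdgeSetConnected C'.X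

/-- An edge `e ∉ X` is essential if neither `(G/e, X ∩ E(G/e))` nor `(G∖e, X)` has a
3-connected constraint minor with disconnected constraint. -/
def Essential (C : CGraph) (e : Sym2 C.V) : Prop :=
  ¬ BadMinor (C.deleteEdge e) ∧
  ∀ u v, ∀ h : C.G.Adj u v, s(u, v) = e → ¬ BadMinor (C.contract u v h.ne)

/-- An edge joining two distinct components of `G[X]`. -/
def JoinsComponents {V : Type*} (X : Set (Sym2 V)) (e : Sym2 V) : Prop :=
  ∃ a b, e = s(a, b) ∧ a ∈ (fromEdgeSet X).support ∧ b ∈ (fromEdgeSet X).support ∧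
    ¬ (fromEdgeSet X).Reachable a b

/-- The degree of a vertex. -/
noncomputable def vdeg {V : Type*} (G : SimpleGraph V) (v : V) : ℕ := (G.neighborSet v).ncard

/-- The component of `G[X]` containing the edge `f` consists of the single edge `f`. -/
def SingleEdgeComponent {V : Type*} (X : Set (Sym2 V)) (f : Sym2 V) : Prop :=
  f ∈ X ∧ ∀ g ∈ X, (∃ a ∈ f, ∃ b ∈ g, (fromEdgeSet X).Reachable a b) → g = f

/-- The edges of `Q` with all endvertices in `S`: the edges of the side `Q[S]`. -/
def sideEdges {V : Type*} (Q : SimpleGraph V) (S : Set V) : Set (Sym2 V) :=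
  {e | e ∈ Q.edgeSet ∧ ∀ v ∈ e, v ∈ S}

/-- The edges of `Q` with one endvertex in `S` and one outside `S`. -/
def crossEdges {V : Type*} (Q : SimpleGraph V) (S : Set V) : Set (Sym2 V) :=
  {e | e ∈ Q.edgeSet ∧ (∃ v ∈ e, v ∈ S) ∧ ∃ v ∈ e, v ∉ S}

/-- `d` is a bond of `Q` with sides induced by `S` and `Sᶜ`. -/
def IsBondWith {V : Type*} (Q : SimpleGraph V) (d : Set (Sym2 V)) (S : Set V) : Prop :=
  S.Nonempty ∧ Sᶜ.Nonempty ∧ (Q.induce S).Connected ∧ (Q.induce Sᶜ).Connected ∧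
    d = crossEdges Q S

/-- `Q` is 3-connected along the bond `d` (with left side `S`): `Q` is 2-connected and no pair
of vertices, one from each side, separates `Q`. -/
def ThreeConnAlong {V : Type*} (Q : SimpleGraph V) (d : Set (Sym2 V)) (S : Set V) : Prop :=
  IsBondWith Q d S ∧ KConnected 2 Q ∧
    ∀ x ∈ S, ∀ y ∈ Sᶜ, (Q.induce ({x, y}ᶜ : Set V)).Preconnected

/-- One step of a special contraction minor: contract an edge not in the bond. -/
inductive SCMStep : CGraph → CGraph → Prop
  | contr (C : CGraph) (u v : C.V) (h : C.G.Adj u v) (hd : s(u, v) ∉ C.X) :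
      SCMStep C (C.contract u v h.ne)

/-- The special-contraction-minor relation. -/
def IsSCMinor : CGraph → CGraph → Prop := Relation.ReflTransGen SCMStep

/-- A proper (non-identical) special contraction minor. -/
def IsProperSCMinor : CGraph → CGraph → Prop := Relation.TransGen SCMStep

/-- The special `K₄`: `K₄` together with a bond of size 4. -/
def specialK4 : CGraph where
  V := Fin 4
  G := ⊤
  X := {s(0, 2), s(0, 3), s(1, 2), s(1, 3)}

/-- The special prism: the prism together with the bond complementing the two triangles. -/
def specialPrism : CGraph where
  V := Fin 6
  G := prismGraph
  X := {s(0, 3), s(1, 4), s(2, 5)}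

/-- `(Q, d)` is 3-connected along `d` and both sides of `d` contain edges. -/
def GoodAlong (C : CGraph) : Prop :=
  ∃ S : Set C.V, ThreeConnAlong C.G C.X S ∧
    (sideEdges C.G S).Nonempty ∧ (sideEdges C.G Sᶜ).Nonempty

/-- `(Q, d)` is irreducible. -/
def BondIrreducible (C : CGraph) : Prop :=
  (∃ S : Set C.V, ThreeConnAlong C.G C.X S) ∧
  ¬ ∃ C', IsProperSCMinor C C' ∧ GoodAlong C'

/-- An edge set forming a triangle. -/
def IsTriangle {V : Type*} (X : Set (Sym2 V)) : Prop :=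
  ∃ a b c : V, a ≠ b ∧ a ≠ c ∧ b ≠ c ∧ X = {s(a, b), s(b, c), s(a, c)}

/-- An edge set consisting of a single edge. -/
def IsSingleEdge {V : Type*} (X : Set (Sym2 V)) : Prop :=
  ∃ a b : V, a ≠ b ∧ X = {s(a, b)}

/-- `M` is (isomorphic to) the cycle matroid of `G`, via the bijection `f` between the ground
set of `M` and the edges of `G`: a set is independent iff its image is a forest. -/
def IsGraphicRep {α : Type} (M : Matroid α) {V : Type} (G : SimpleGraph V)
    (f : α → Sym2 V) : Prop :=
  Set.BijOn f M.E G.edgeSet ∧ ∀ I ⊆ M.E, (M.Indep I ↔ (fromEdgeSet (f '' I)).IsAcyclic)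

/-- The constraint matroid `(M, X)` is realisable. -/
def Realisable {α : Type} (M : Matroid α) (X : Set α) : Prop :=
  ∃ (V : Type) (_ : Finite V) (G : SimpleGraph V) (f : α → Sym2 V),
    IsGraphicRep M G f ∧ EdgeSetConnected (f '' X)

/-- Deletion of a set of elements from a matroid. -/
def Matroid.del {α : Type} (M : Matroid α) (D : Set α) : Matroid α := Matroid.restrict M (M.E \ D)

/-- Contraction of a set of elements of a matroid. -/
def Matroid.con {α : Type} (M : Matroid α) (C : Set α) : Matroid α :=
  Matroid.dual (Matroid.del (Matroid.dual M) C)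

/-- `(N, Y)` is a constraint minor of `(M, X)`: contract an arbitrary set `C` and delete a
set `D` of elements not in `X`. -/
def MatroidCMinor {α : Type} (M : Matroid α) (X : Set α) (N : Matroid α) (Y : Set α) : Prop :=
  ∃ C D : Set α, D ⊆ M.E \ X ∧ N = (M.con C).del D ∧ Y = X \ C

/-- `(N, Y)` is isomorphic, via the cycle matroid, to one of the six obstructions. -/
def MatroidObstruction {α : Type} (N : Matroid α) (Y : Set α) : Prop :=
  (∃ f : α → Sym2 (Fin 4), IsGraphicRep N constraintK4.G f ∧ f '' Y = constraintK4.X) ∨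
  (∃ f : α → Sym2 (Fin 5), IsGraphicRep N constraintWheel.G f ∧ f '' Y = constraintWheel.X) ∨
  (∃ X, PrismConstraintSet X ∧
    ∃ f : α → Sym2 (Fin 6), IsGraphicRep N prismGraph f ∧ f '' Y = X)

namespace EssTri

/-- No set of at most two vertices separates. -/
def Sep {V : Type*} (G : SimpleGraph V) : Prop :=
  ∀ S U : Set V, S.ncard ≤ 2 → (∃ p, p ∉ S ∧ p ∈ U) → (∃ q, q ∉ S ∧ q ∉ U) →
    ∃ p q, p ∉ S ∧ q ∉ S ∧ p ∈ U ∧ q ∉ U ∧ G.Adj p q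

lemma reach_inv {V : Type*} (G : SimpleGraph V) (U : Set V)
    (h : ∀ x y, G.Adj x y → x ∈ U → y ∈ U) {x y : V} (hr : G.Reachable x y) (hx : x ∈ U) :
    y ∈ U := by
  obtain ⟨w⟩ := hr
  induction w with
  | nil => exact hx
  | cons hadj _ ih => exact ih (h _ _ hadj hx)

lemma sep_of_kconn {V : Type*} {G : SimpleGraph V} (h : KConnected 3 G) : Sep G := by
  intro S U hS ⟨p, hpS, hpU⟩ ⟨q, hqS, hqU⟩
  by_contra hcon
  push Not at hcon
  have hc := h.2 S (by omega)
  have hr := hc.preconnected ⟨p, hpS⟩ ⟨q, hqS⟩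
  apply hqU
  exact reach_inv _ {x : (Sᶜ : Set V) | (x : V) ∈ U} (by
    rintro ⟨x, hx⟩ ⟨y, hy⟩ hadj hxU
    by_contra hyU
    exact hcon x y hx hy hxU hyU hadj) hr hpU

lemma kconn_of_sep {V : Type*} [Finite V] {G : SimpleGraph V} (hc : 3 < Nat.card V)
    (h : Sep G) : KConnected 3 G := by
  refine ⟨hc, fun S hS => ?_⟩
  have hne : (Sᶜ : Set V).Nonempty := by
    by_contra hcon
    rw [Set.not_nonempty_iff_eq_empty, Set.compl_empty_iff] at hcon
    rw [hcon, Set.ncard_univ] at hS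
    omega
  have : Nonempty (Sᶜ : Set V) := hne.to_subtype
  refine ⟨?_⟩
  intro u v
  by_contra hr
  obtain ⟨p, q, hp, hq, ⟨hp', hpr⟩, hqU, hadj⟩ := h S
    {x | ∃ hx : x ∈ (Sᶜ : Set V), (G.induce Sᶜ).Reachable u ⟨x, hx⟩} (by omega)
    ⟨u, u.2, u.2, Reachable.refl _⟩ ⟨v, v.2, fun ⟨_, h⟩ => hr h⟩
  apply hqU
  refine ⟨hq, hpr.trans ?_⟩
  apply Adj.reachable
  exact hadj

lemma ncard_le_two_of {V : Type*} [Finite V] {S T : Set V} {b d : V} (hS : S.ncard ≤ 2)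
    (hd : d ∈ S) (hT : ∀ x ∈ T, x = b ∨ (x ∈ S ∧ x ≠ d)) : T.ncard ≤ 2 := by
  have h1 : T ⊆ insert b (S \ {d}) := by
    intro x hx
    rcases hT x hx with h | h
    · exact Or.inl h
    · exact Or.inr ⟨h.1, h.2⟩
  have h2 := Set.ncard_le_ncard h1
  have h3 := Set.ncard_insert_le b (S \ {d})
  have h4 := Set.ncard_sdiff_singleton_lt_of_mem hd
  omega

lemma pair_le_two {V : Type*} (x y : V) : ({x, y} : Set V).ncard ≤ 2 := by
  have := Set.ncard_insert_le x ({y} : Set V)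
  rw [Set.ncard_singleton] at this
  omega

/-- A 3-separation whose separator contains the edge `ab`. -/
structure Sep3 {V : Type*} (G : SimpleGraph V) (a b c : V) (A B : Set V) : Prop where
  ab : a ≠ b
  ac : a ≠ c
  bc : b ≠ c
  aA : a ∉ A
  aB : a ∉ B
  bA : b ∉ A
  bB : b ∉ B
  cA : c ∉ A
  cB : c ∉ B
  disj : ∀ x ∈ A, x ∉ B
  cov : ∀ x, x = a ∨ x = b ∨ x = c ∨ x ∈ A ∨ x ∈ B
  neA : A.Nonempty
  neB : B.Nonempty
  noadj : ∀ x ∈ A, ∀ y ∈ B, ¬ G.Adj x y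

lemma Sep3.swap {V : Type*} {G : SimpleGraph V} {a b c : V} {A B : Set V}
    (h : Sep3 G a b c A B) : Sep3 G a b c B A where
  ab := h.ab
  ac := h.ac
  bc := h.bc
  aA := h.aB
  aB := h.aA
  bA := h.bB
  bB := h.bA
  cA := h.cB
  cB := h.cA
  disj := fun x hx hx' => h.disj x hx' hx
  cov := fun x => by have := h.cov x; tauto
  neA := h.neB
  neB := h.neA
  noadj := fun x hx y hy hadj => h.noadj y hy x hx hadj.symm

lemma Sep3.flip {V : Type*} {G : SimpleGraph V} {a b c : V} {A B : Set V}
    (h : Sep3 G a b c A B) : Sep3 G b a c A B where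
  ab := h.ab.symm
  ac := h.bc
  bc := h.ac
  aA := h.bA
  aB := h.bB
  bA := h.aA
  bB := h.aB
  cA := h.cA
  cB := h.cB
  disj := h.disj
  cov := fun x => by have := h.cov x; tauto
  neA := h.neA
  neB := h.neB
  noadj := h.noadj

/-- If part of the side of `b` lies in `A` then the 2-separator avoids `B`. -/
lemma key_aux {V : Type*} [Finite V] {G : SimpleGraph V} (hG : Sep G) {a b c : V} {A B : Set V}
    (h : Sep3 G a b c A B) {S U : Set V} (hS : S.ncard ≤ 2)
    (hno : ∀ p q, p ∉ S → q ∉ S → p ∈ U → q ∉ U → G.Adj p q → s(p, q) = s(a, b))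
    (haU : a ∈ U) (haS : a ∉ S) (hc : c ∈ U ∨ c ∈ S)
    {q : V} (hqS : q ∉ S) (hqU : q ∉ U) (hqA : q ∈ A) (T : Set V) (hT : T.ncard ≤ 2)
    (hbT : b ∈ T) (hST : ∀ x ∈ S, x ∈ A ∨ x = c → x ∈ T) (hTS : ∀ x ∈ T, x = b ∨ x ∈ S) :
    False := by
  obtain ⟨x, y, hxT, hyT, ⟨hxA, hxU, hxS⟩, hy, hadj⟩ := hG T {x | x ∈ A ∧ x ∉ U ∧ x ∉ S} hT
    ⟨q, fun hq => by
      rcases hTS q hq with rfl | h'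
      · exact h.bA hqA
      · exact hqS h', hqA, hqU, hqS⟩
    ⟨a, fun ha => by
      rcases hTS a ha with h' | h'
      · exact h.ab h'
      · exact haS h', fun h' => h.aA h'.1⟩
  have hxa : x ≠ a := fun h' => h.aA (h' ▸ hxA)
  have hxb : x ≠ b := fun h' => h.bA (h' ▸ hxA)
  have hyb : y ≠ b := fun h' => hyT (h' ▸ hbT)
  by_cases hyS : y ∈ S
  · have hyA : y ∉ A := fun h' => hyT (hST y hyS (Or.inl h'))
    have hyc : y ≠ c := fun h' => hyT (hST y hyS (Or.inr h'))
    have hyB : y ∉ B := fun h' => h.noadj x hxA y h' hadj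
    rcases h.cov y with h' | h' | h' | h' | h'
    · exact haS (h' ▸ hyS)
    all_goals contradiction
  · by_cases hyU : y ∈ U
    · have := hno y x hyS hxS hyU hxU hadj.symm
      rw [Sym2.eq_iff] at this
      tauto
    · have hyA : y ∉ A := fun h' => hy ⟨h', hyU, hyS⟩
      have hyc : y ≠ c := by
        rintro rfl
        tauto
      have hyB : y ∉ B := fun h' => h.noadj x hxA y h' hadj
      rcases h.cov y with h' | h' | h' | h' | h'
      · exact hyU (h' ▸ haU)
      all_goals contradiction

lemma key_half {V : Type*} [Finite V] {G : SimpleGraph V} (hG : Sep G) {a b c : V} {A B : Set V}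
    (h : Sep3 G a b c A B) {S U : Set V} (hS : S.ncard ≤ 2)
    (hno : ∀ p q, p ∉ S → q ∉ S → p ∈ U → q ∉ U → G.Adj p q → s(p, q) = s(a, b))
    (haU : a ∈ U) (haS : a ∉ S) (hbU : b ∉ U) (hbS : b ∉ S) (hc : c ∈ U ∨ c ∈ S)
    {q : V} (hqS : q ∉ S) (hqU : q ∉ U) (hqA : q ∈ A) : False := by
  have hSB : ∀ d ∈ S, d ∉ B := by
    intro d hd hdB
    refine key_aux hG h hS hno haU haS hc hqS hqU hqA (insert b (S \ {d})) ?_ (Or.inl rfl) ?_ ?_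
    · exact ncard_le_two_of (b := b) hS hd (fun x hx => hx)
    · rintro x hxS (hx | hx)
      · exact Or.inr ⟨hxS, fun h' => h.disj x hx (by rw [h']; exact hdB)⟩
      · exact Or.inr ⟨hxS, fun h' => h.cB (by rw [← hx, h']; exact hdB)⟩
    · rintro x (hx | hx)
      · exact Or.inl hx
      · exact Or.inr hx.1
  have hQB : ∀ r, r ∉ S → r ∉ U → r ∉ B := by
    intro r hrS hrU hrB
    have hSA : ∀ d ∈ S, d ∉ A := by
      intro d hd hdA
      refine key_aux hG h.swap hS hno haU haS hc hrS hrU hrB (insert b (S \ {d})) ?_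
        (Or.inl rfl) ?_ ?_
      · exact ncard_le_two_of (b := b) hS hd (fun x hx => hx)
      · rintro x hxS (hx | hx)
        · exact Or.inr ⟨hxS, fun h' => h.disj x (by rw [h']; exact hdA) hx⟩
        · exact Or.inr ⟨hxS, fun h' => h.cA (by rw [← hx, h']; exact hdA)⟩
      · rintro x (hx | hx)
        · exact Or.inl hx
        · exact Or.inr hx.1
    refine key_aux hG h hS hno haU haS hc hqS hqU hqA (insert b (S ∩ {c})) ?_ (Or.inl rfl) ?_ ?_
    · exact (Set.ncard_le_ncard (t := {b, c}) (by
        rintro x (hx | hx)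
        · exact Or.inl hx
        · exact Or.inr hx.2)).trans (pair_le_two b c)
    · rintro x hxS (hx | hx)
      · exact absurd hx (hSA x hxS)
      · exact Or.inr ⟨hxS, hx⟩
    · rintro x (hx | hx)
      · exact Or.inl hx
      · exact Or.inr hx.1
  obtain ⟨d, hd⟩ := h.neB
  obtain ⟨x, y, hxT, hyT, hxB, hyB, hadj⟩ := hG {a, c} B (pair_le_two a c)
    ⟨d, by
      rintro (h' | h')
      · exact h.aB (h' ▸ hd)
      · exact h.cB (by rw [← h']; exact hd), hd⟩
    ⟨b, by
      rintro (h' | h')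
      · exact h.ab h'.symm
      · exact h.bc h', h.bB⟩
  have hxS : x ∉ S := fun h' => hSB x h' hxB
  have hxU : x ∈ U := by
    by_contra h'
    exact hQB x hxS h' hxB
  have hya : y ≠ a := fun h' => hyT (Or.inl h')
  have hyc : y ≠ c := fun h' => hyT (Or.inr h')
  have hyA : y ∉ A := fun h' => h.noadj y h' x hxB hadj.symm
  rcases h.cov y with h' | h' | h' | h' | h'
  · exact hya h'
  · rw [h'] at hadj
    have := hno x b hxS hbS hxU hbU hadj
    rw [Sym2.eq_iff] at this
    rcases this with h'' | h''
    · exact h.aB (h''.1 ▸ hxB)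
    · exact h.bB (h''.1 ▸ hxB)
  all_goals contradiction

lemma key_half' {V : Type*} [Finite V] {G : SimpleGraph V} (hG : Sep G) {a b c : V} {A B : Set V}
    (h : Sep3 G a b c A B) {S U : Set V} (hS : S.ncard ≤ 2)
    (hno : ∀ p q, p ∉ S → q ∉ S → p ∈ U → q ∉ U → G.Adj p q → s(p, q) = s(a, b))
    (haU : a ∈ U) (haS : a ∉ S) (hbU : b ∉ U) (hbS : b ∉ S) (hc : c ∈ U ∨ c ∈ S)
    {q : V} (hqS : q ∉ S) (hqU : q ∉ U) : q = b := by
  rcases h.cov q with h' | h' | h' | h' | h'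
  · exact absurd (h' ▸ haU) hqU
  · exact h'
  · rw [h'] at hqS hqU
    tauto
  · exact (key_half hG h hS hno haU haS hbU hbS hc hqS hqU h').elim
  · exact (key_half hG h.swap hS hno haU haS hbU hbS hc hqS hqU h').elim

lemma key_or {V : Type*} [Finite V] {G : SimpleGraph V} (hG : Sep G) {a b c : V} {A B : Set V}
    (h : Sep3 G a b c A B) {S U : Set V} (hS : S.ncard ≤ 2)
    (hno : ∀ p q, p ∉ S → q ∉ S → p ∈ U → q ∉ U → G.Adj p q → s(p, q) = s(a, b))
    (haU : a ∈ U) (haS : a ∉ S) (hbU : b ∉ U) (hbS : b ∉ S) :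
    (∀ q, q ∉ S → q ∉ U → q = b) ∨ (∀ q, q ∉ S → q ∈ U → q = a) := by
  by_cases hc : c ∈ U ∨ c ∈ S
  · exact Or.inl fun q hqS hqU => key_half' hG h hS hno haU haS hbU hbS hc hqS hqU
  · right
    intro q hqS hqU
    refine key_half' hG h.flip (U := Uᶜ) hS ?_ hbU hbS (fun h' => h' haU) haS
      (Or.inl (fun h' => hc (Or.inl h'))) hqS (fun h' => h' hqU)
    intro p q hp hq hpU hqU hadj
    have := hno q p hq hp (by simpa using hqU) hpU hadj.symm
    rw [Sym2.eq_swap, this, Sym2.eq_swap]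

/-- Any 2-separation of `G \ ab` isolates an end of `ab`. -/
lemma key {V : Type*} [Finite V] {G : SimpleGraph V} (hG : Sep G) {a b c : V} {A B : Set V}
    (h : Sep3 G a b c A B) {S U : Set V} (hS : S.ncard ≤ 2)
    (hno : ∀ p q, p ∉ S → q ∉ S → p ∈ U → q ∉ U → G.Adj p q → s(p, q) = s(a, b))
    (hp : ∃ p, p ∉ S ∧ p ∈ U) (hq : ∃ q, q ∉ S ∧ q ∉ U) :
    ∃ w, (w = a ∨ w = b) ∧ vdeg G w ≤ 3 ∧
      ((∀ q, q ∉ S → q ∉ U → q = w) ∨ (∀ q, q ∉ S → q ∈ U → q = w)) := by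
  have hdeg : ∀ w z, (∀ y, G.Adj w y → y = z ∨ y ∈ S) → vdeg G w ≤ 3 := by
    intro w z hw
    have h1 : G.neighborSet w ⊆ insert z S := fun y hy => hw y hy
    have h2 := Set.ncard_le_ncard h1
    have h3 := Set.ncard_insert_le z S
    unfold vdeg
    omega
  have main : ∃ w, (w = a ∨ w = b) ∧
      ((∀ q, q ∉ S → q ∉ U → q = w) ∨ (∀ q, q ∉ S → q ∈ U → q = w)) := by
    obtain ⟨x, y, hxS, hyS, hxU, hyU, hadj⟩ := hG S U hS hp hq
    have hxy := hno x y hxS hyS hxU hyU hadj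
    rw [Sym2.eq_iff] at hxy
    rcases hxy with ⟨rfl, rfl⟩ | ⟨rfl, rfl⟩
    · rcases key_or hG h hS hno hxU hxS hyU hyS with h' | h'
      · exact ⟨y, Or.inr rfl, Or.inl h'⟩
      · exact ⟨x, Or.inl rfl, Or.inr h'⟩
    · rcases key_or hG h.flip hS (fun p q h1 h2 h3 h4 h5 => by
        rw [hno p q h1 h2 h3 h4 h5, Sym2.eq_swap]) hxU hxS hyU hyS with h' | h'
      · exact ⟨y, Or.inl rfl, Or.inl h'⟩
      · exact ⟨x, Or.inr rfl, Or.inr h'⟩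
  obtain ⟨w, hw, hside⟩ := main
  refine ⟨w, hw, ?_, hside⟩
  obtain ⟨z, hz⟩ : ∃ z, ∀ y, s(w, y) = s(a, b) → y = z := by
    rcases hw with rfl | rfl
    · exact ⟨b, fun y hy => by have := h.ab; rw [Sym2.eq_iff] at hy; grind⟩
    · exact ⟨a, fun y hy => by have := h.ab; rw [Sym2.eq_iff] at hy; grind⟩
  apply hdeg w z
  intro y hadj
  by_cases hyS : y ∈ S
  · exact Or.inr hyS
  left
  apply hz
  rcases hside with hs | hs
  · obtain ⟨q, hqS, hqU⟩ := hq
    have := hs q hqS hqU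
    subst this
    have hyU : y ∈ U := by
      by_contra h'
      exact hadj.ne (hs y hyS h').symm
    rw [Sym2.eq_swap]
    exact hno _ _ hyS hqS hyU hqU hadj.symm
  · obtain ⟨q, hqS, hqU⟩ := hp
    have := hs q hqS hqU
    subst this
    have hyU : y ∉ U := by
      intro h'
      exact hadj.ne (hs y hyS h').symm
    exact hno _ _ hqS hyS hqU hyU hadj

lemma cf_self {V : Type*} {u v : V} (huv : u ≠ v) : contractFun huv v = ⟨u, huv⟩ := by
  simp [contractFun]

lemma cf_ne {V : Type*} {u v : V} (huv : u ≠ v) {x : V} (hx : x ≠ v) :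
    contractFun huv x = ⟨x, hx⟩ := by
  simp [contractFun, hx]

lemma contract_adj {V : Type*} (G : SimpleGraph V) {u v : V} (huv : u ≠ v)
    (x y : {w : V // w ≠ v}) :
    (contractGraph G huv).Adj x y ↔
      x ≠ y ∧ ∃ p q, G.Adj p q ∧ contractFun huv p = x ∧ contractFun huv q = y := by
  unfold contractGraph
  rw [fromEdgeSet_adj]
  constructor
  · rintro ⟨⟨e, he, hmap⟩, hne⟩
    refine ⟨hne, ?_⟩
    induction e with
    | _ p q =>
      rw [Sym2.map_mk, Sym2.eq_iff] at hmap
      rcases hmap with h | h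
      · exact ⟨p, q, he, h.1, h.2⟩
      · exact ⟨q, p, G.adj_symm he, h.2, h.1⟩
  · rintro ⟨hne, p, q, hadj, rfl, rfl⟩
    exact ⟨⟨s(p, q), hadj, rfl⟩, hne⟩

/-- Edges avoiding the contracted vertex survive. -/
lemma contract_adj_of {V : Type*} (G : SimpleGraph V) {u v : V} (huv : u ≠ v)
    {x y : V} (hx : x ≠ v) (hy : y ≠ v) (h : G.Adj x y) :
    (contractGraph G huv).Adj ⟨x, hx⟩ ⟨y, hy⟩ := by
  rw [contract_adj]
  exact ⟨fun h' => h.ne (congrArg Subtype.val h'), x, y, h, cf_ne huv hx, cf_ne huv hy⟩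

/-- Edges at the contracted vertex become edges at its image. -/
lemma contract_adj_of' {V : Type*} (G : SimpleGraph V) {u v : V} (huv : u ≠ v)
    {y : V} (hy : y ≠ v) (h : G.Adj v y) (huy : u ≠ y) :
    (contractGraph G huv).Adj ⟨u, huv⟩ ⟨y, hy⟩ := by
  rw [contract_adj]
  exact ⟨fun h' => huy (congrArg Subtype.val h'), v, y, h, cf_self huv, cf_ne huv hy⟩

/-- Lifting a separation through the suppression of a vertex of degree two. -/
lemma lift {V : Type*} (D : SimpleGraph V) {a a1 a2 : V} (h1 : a1 ≠ a) (h2 : a2 ≠ a)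
    (hadj2 : D.Adj a a2) (hN : ∀ y, D.Adj a y → y = a1 ∨ y = a2)
    (S U : Set {w : V // w ≠ a})
    (hno : ∀ p q, p ∉ S → q ∉ S → p ∈ U → q ∉ U → ¬ (contractGraph D h1).Adj p q) :
    ∃ S' U' : Set V, S'.ncard = S.ncard ∧ (∀ x : {w : V // w ≠ a}, (x : V) ∈ S' ↔ x ∈ S) ∧
      (∀ x : {w : V // w ≠ a}, (x : V) ∈ U' ↔ x ∈ U) ∧
      (∀ p q, p ∉ S' → q ∉ S' → p ∈ U' → q ∉ U' → ¬ D.Adj p q) := by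
  have hiff : ∀ (T : Set {w : V // w ≠ a}) (x : V) (hx : x ≠ a),
      x ∈ Subtype.val '' T ↔ ⟨x, hx⟩ ∈ T := by
    intro T x hx
    constructor
    · rintro ⟨y, hy, rfl⟩
      exact hy
    · intro h
      exact ⟨_, h, rfl⟩
  let P : Prop := ((⟨a1, h1⟩ : {w : V // w ≠ a}) ∈ U ∧ (⟨a1, h1⟩ : {w : V // w ≠ a}) ∉ S) ∨
    ((⟨a2, h2⟩ : {w : V // w ≠ a}) ∈ U ∧ (⟨a2, h2⟩ : {w : V // w ≠ a}) ∉ S)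
  refine ⟨Subtype.val '' S, Subtype.val '' U ∪ {x | x = a ∧ P}, ?_, ?_, ?_, ?_⟩
  · exact Set.ncard_image_of_injective S Subtype.val_injective
  · intro x
    exact hiff S x x.2
  · intro x
    constructor
    · rintro (h | h)
      · exact (hiff U x x.2).1 h
      · exact absurd h.1 x.2
    · intro h
      exact Or.inl ((hiff U x x.2).2 h)
  · intro p q hp hq hpU hqU hadj
    by_cases hpa : p = a
    · subst hpa
      have hP : P := by
        rcases hpU with ⟨y, _, hy⟩ | h
        · exact absurd hy y.2
        · exact h.2
      have hqp : q ≠ p := hadj.ne'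
      have hqS : (⟨q, hqp⟩ : {w : V // w ≠ p}) ∉ S := fun h => hq ((hiff S q hqp).2 h)
      have hqU' : (⟨q, hqp⟩ : {w : V // w ≠ p}) ∉ U :=
        fun h => hqU (Or.inl ((hiff U q hqp).2 h))
      rcases hN q hadj with rfl | rfl
      · rcases hP with hP | hP
        · exact hqU' hP.1
        · have hne : q ≠ a2 := by
            rintro rfl
            exact hqU' hP.1
          exact hno _ _ hP.2 hqS hP.1 hqU' (contract_adj_of' D h1 h2 hadj2 hne).symm
      · rcases hP with hP | hP
        · have hne : a1 ≠ q := by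
            rintro rfl
            exact hqU' hP.1
          exact hno _ _ hP.2 hqS hP.1 hqU' (contract_adj_of' D h1 h2 hadj2 hne)
        · exact hqU' hP.1
    · have hpS : (⟨p, hpa⟩ : {w : V // w ≠ a}) ∉ S := fun h => hp ((hiff S p hpa).2 h)
      have hpU' : (⟨p, hpa⟩ : {w : V // w ≠ a}) ∈ U := by
        rcases hpU with h | h
        · exact (hiff U p hpa).1 h
        · exact absurd h.1 hpa
      by_cases hqa : q = a
      · subst hqa
        apply hqU
        right
        refine ⟨rfl, ?_⟩
        rcases hN p hadj.symm with rfl | rfl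
        · exact Or.inl ⟨hpU', hpS⟩
        · exact Or.inr ⟨hpU', hpS⟩
      · exact hno _ _ hpS (fun h => hq ((hiff S q hqa).2 h)) hpU'
          (fun h => hqU (Or.inl ((hiff U q hqa).2 h))) (contract_adj_of D h1 hpa hqa hadj)

lemma card_contract {V : Type*} [Finite V] (a : V) :
    Nat.card {w : V // w ≠ a} + 1 = Nat.card V := by
  have h := Set.ncard_add_ncard_compl ({a} : Set V)
  rw [Set.ncard_singleton] at h
  have h2 : Nat.card {w : V // w ≠ a} = ({a}ᶜ : Set V).ncard := rfl
  omega

/-- Vertices of degree three with a distinguished neighbour. -/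
lemma nbrs {V : Type*} [Finite V] {G : SimpleGraph V} {a b : V} (hab : G.Adj a b)
    (hd : vdeg G a = 3) : ∃ a1 a2, a1 ≠ a2 ∧ a1 ≠ b ∧ a2 ≠ b ∧ G.Adj a a1 ∧ G.Adj a a2 ∧
      ∀ y, G.Adj a y → y = b ∨ y = a1 ∨ y = a2 := by
  unfold vdeg at hd
  obtain ⟨x, y, z, hxy, hxz, hyz, hN⟩ := Set.ncard_eq_three.1 hd
  have hm : ∀ w, G.Adj a w ↔ w = x ∨ w = y ∨ w = z := by
    intro w
    rw [← mem_neighborSet, hN]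
    simp
  rcases (hm b).1 hab with rfl | rfl | rfl
  · exact ⟨y, z, hyz, hxy.symm, hxz.symm, (hm y).2 (by tauto), (hm z).2 (by tauto),
      fun w hw => by have := (hm w).1 hw; tauto⟩
  · exact ⟨x, z, hxz, hxy, hyz.symm, (hm x).2 (by tauto), (hm z).2 (by tauto),
      fun w hw => by have := (hm w).1 hw; tauto⟩
  · exact ⟨x, y, hxy, hxz, hyz, (hm x).2 (by tauto), (hm y).2 (by tauto),
      fun w hw => by have := (hm w).1 hw; tauto⟩

lemma three_le_deg {V : Type*} [Finite V] {G : SimpleGraph V} (hG : Sep G)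
    (hc : 3 < Nat.card V) (a : V) : 3 ≤ vdeg G a := by
  by_contra hlt
  unfold vdeg at hlt
  obtain ⟨q, hq⟩ : ∃ q, q ∉ insert a (G.neighborSet a) := by
    by_contra hcon
    push Not at hcon
    have h1 := Set.ncard_insert_le a (G.neighborSet a)
    rw [Set.eq_univ_of_forall hcon, Set.ncard_univ] at h1
    omega
  obtain ⟨x, y, _, hy, hx, _, hadj⟩ := hG (G.neighborSet a) {a} (by omega)
    ⟨a, by simp, rfl⟩ ⟨q, fun h => hq (Or.inr h), fun h => hq (Or.inl h)⟩
  rw [Set.mem_singleton_iff] at hx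
  subst hx
  exact hy hadj

/-- If contracting `ab` destroys 3-connectedness there is a 3-separation through `ab`. -/
lemma exists_sep3 {V : Type*} [Finite V] {G : SimpleGraph V} (hG : Sep G) {a b : V}
    (hab : a ≠ b) (hn : ¬ Sep (contractGraph G hab)) :
    ∃ c A B, Sep3 G a b c A B := by
  unfold Sep at hn
  push Not at hn
  obtain ⟨S, U, hS, ⟨p, hpS, hpU⟩, ⟨q, hqS, hqU⟩, hno⟩ := hn
  have hiff : ∀ (T : Set {w : V // w ≠ b}) (x : V) (hx : x ≠ b),
      x ∈ Subtype.val '' T ↔ ⟨x, hx⟩ ∈ T := by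
    intro T x hx
    constructor
    · rintro ⟨y, hy, rfl⟩
      exact hy
    · intro h
      exact ⟨_, h, rfl⟩
  have haS : (⟨a, hab⟩ : {w : V // w ≠ b}) ∈ S := by
    by_contra haS
    obtain ⟨x, y, hxS, hyS, hxU, hyU, hadj⟩ := hG (Subtype.val '' S)
      {x | contractFun hab x ∈ U}
      (by rw [Set.ncard_image_of_injective S Subtype.val_injective]; exact hS)
      ⟨p, fun h => hpS ((hiff S p p.2).1 h), by
        change contractFun hab p ∈ U
        rw [cf_ne hab p.2]; exact hpU⟩
      ⟨q, fun h => hqS ((hiff S q q.2).1 h), by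
        change contractFun hab q ∉ U
        rw [cf_ne hab q.2]; exact hqU⟩
    have hcf : ∀ x, x ∉ Subtype.val '' S → contractFun hab x ∉ S := by
      intro x hx
      by_cases hxb : x = b
      · rw [hxb, cf_self]; exact haS
      · rw [cf_ne hab hxb]
        exact fun h => hx ((hiff S x hxb).2 h)
    refine hno _ _ (hcf x hxS) (hcf y hyS) hxU hyU ?_
    rw [contract_adj]
    exact ⟨fun h => hyU (by
      change contractFun hab y ∈ U
      rw [← h]; exact hxU), x, y, hadj, rfl, rfl⟩
  have hS1 : (S \ {⟨a, hab⟩}).ncard ≤ 1 := by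
    have := Set.ncard_sdiff_singleton_lt_of_mem haS
    omega
  -- the sides of the separation in `G`
  have hnoG : ∀ x y, x ∈ Subtype.val '' (U \ S) → y ∈ Subtype.val '' (Uᶜ \ S) →
      ¬ G.Adj x y := by
    rintro _ _ ⟨x, hx, rfl⟩ ⟨y, hy, rfl⟩ hadj
    exact hno x y hx.2 hy.2 hx.1 hy.1 (contract_adj_of G hab x.2 y.2 hadj)
  obtain ⟨c, hc⟩ : ∃ c, c ∈ S \ {⟨a, hab⟩} := by
    by_contra hcon
    push Not at hcon
    have hSa : ∀ x ∈ S, x = ⟨a, hab⟩ := by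
      intro x hx
      by_contra hne
      exact hcon x ⟨hx, hne⟩
    have hmem : ∀ x : V, x ∉ ({a, b} : Set V) → ∃ hx : x ≠ b, (⟨x, hx⟩ : {w // w ≠ b}) ∉ S := by
      intro x hx
      have h1 : x ≠ a := fun h => hx (Or.inl h)
      have h2 : x ≠ b := fun h => hx (Or.inr h)
      exact ⟨h2, fun h => h1 (congrArg Subtype.val (hSa _ h))⟩
    have hmem' : ∀ x : {w // w ≠ b}, x ∉ S → (x : V) ∉ ({a, b} : Set V) := by
      rintro x hx (h | h)
      · apply hx
        have : x = ⟨a, hab⟩ := Subtype.ext h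
        rw [this]; exact haS
      · exact x.2 h
    obtain ⟨x, y, hxS, hyS, hxU, hyU, hadj⟩ := hG {a, b} (Subtype.val '' U) (pair_le_two a b)
      ⟨p, hmem' p hpS, (hiff U p p.2).2 hpU⟩
      ⟨q, hmem' q hqS, fun h => hqU ((hiff U q q.2).1 h)⟩
    obtain ⟨hxb, hxS'⟩ := hmem x hxS
    obtain ⟨hyb, hyS'⟩ := hmem y hyS
    exact hnoG x y ((hiff _ x hxb).2 ⟨(hiff U x hxb).1 hxU, hxS'⟩)
      ((hiff _ y hyb).2 ⟨fun h => hyU ((hiff U y hyb).2 h), hyS'⟩) hadj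
  have hSac : ∀ x ∈ S, x = ⟨a, hab⟩ ∨ x = c := by
    intro x hx
    by_cases hxa : x = ⟨a, hab⟩
    · exact Or.inl hxa
    · exact Or.inr ((Set.ncard_le_one (Set.toFinite _)).1 hS1 x ⟨hx, hxa⟩ c hc)
  refine ⟨c, Subtype.val '' (U \ S), Subtype.val '' (Uᶜ \ S), ?_⟩
  have hbn : ∀ T : Set {w : V // w ≠ b}, b ∉ Subtype.val '' T := by
    rintro T ⟨x, _, hx⟩
    exact x.2 hx
  refine ⟨hab, fun h => hc.2 (Subtype.ext h.symm), fun h => c.2 h.symm,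
    fun h => ((hiff _ a hab).1 h).2 haS, fun h => ((hiff _ a hab).1 h).2 haS, hbn _, hbn _,
    fun h => ((hiff _ c c.2).1 h).2 hc.1, fun h => ((hiff _ c c.2).1 h).2 hc.1, ?_, ?_,
    ⟨p, p, ⟨hpU, hpS⟩, rfl⟩, ⟨q, q, ⟨hqU, hqS⟩, rfl⟩, fun x hx y hy => hnoG x y hx hy⟩
  · rintro _ ⟨x, hx, rfl⟩ h
    exact ((hiff _ x x.2).1 h).1 hx.1
  · intro x
    by_cases hxb : x = b
    · exact Or.inr (Or.inl hxb)
    by_cases hxS : (⟨x, hxb⟩ : {w : V // w ≠ b}) ∈ S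
    · rcases hSac _ hxS with h | h
      · exact Or.inl (congrArg Subtype.val h)
      · exact Or.inr (Or.inr (Or.inl (congrArg Subtype.val h)))
    · by_cases hxU : (⟨x, hxb⟩ : {w : V // w ≠ b}) ∈ U
      · exact Or.inr (Or.inr (Or.inr (Or.inl ((hiff _ x hxb).2 ⟨hxU, hxS⟩))))
      · exact Or.inr (Or.inr (Or.inr (Or.inr ((hiff _ x hxb).2 ⟨hxU, hxS⟩))))

lemma del_adj {V : Type*} {G : SimpleGraph V} {e : Sym2 V} {x y : V} :
    (G.deleteEdges {e}).Adj x y ↔ G.Adj x y ∧ s(x, y) ≠ e := by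
  rw [deleteEdges_adj, Set.mem_singleton_iff]

/-- Both ends of large degree: deletion stays 3-connected. -/
lemma conn0 {V : Type*} [Finite V] {G : SimpleGraph V} (hG : Sep G) {a b c : V} {A B : Set V}
    (h : Sep3 G a b c A B) (ha : 3 < vdeg G a) (hb : 3 < vdeg G b) :
    Sep (G.deleteEdges {s(a, b)}) := by
  intro S U hS hp hq
  by_contra hcon
  push Not at hcon
  obtain ⟨w, hw, hd, _⟩ := key hG h hS (fun p q h1 h2 h3 h4 h5 => by
    by_contra hne
    exact hcon p q h1 h2 h3 h4 (del_adj.2 ⟨h5, hne⟩)) hp hq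
  rcases hw with rfl | rfl <;> omega

/-- Exactly one end of degree three. -/
lemma conn1 {V : Type*} [Finite V] {G : SimpleGraph V} (hG : Sep G) {a b c : V} {A B : Set V}
    (h : Sep3 G a b c A B) (hb : 3 < vdeg G b) {a1 a2 : V}
    (hb2 : a2 ≠ b) (h1 : a1 ≠ a) (hadj2 : G.Adj a a2)
    (hN : ∀ y, G.Adj a y → y = b ∨ y = a1 ∨ y = a2) :
    Sep (contractGraph (G.deleteEdges {s(a, b)}) h1) := by
  intro S U hS ⟨p, hpS, hpU⟩ ⟨q, hqS, hqU⟩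
  by_contra hcon
  push Not at hcon
  obtain ⟨S', U', hSc, hS', hU', hno⟩ := lift (G.deleteEdges {s(a, b)}) h1 hadj2.ne'
    (del_adj.2 ⟨hadj2, by rw [Ne, Sym2.eq_iff]; have := h.ab; tauto⟩)
    (fun y hy => by
      rw [del_adj] at hy
      rcases hN y hy.1 with rfl | h' | h'
      · exact absurd rfl hy.2
      · exact Or.inl h'
      · exact Or.inr h') S U hcon
  obtain ⟨w, hw, hd, hside⟩ := key hG h (S := S') (U := U') (by omega)
    (fun p q h1 h2 h3 h4 h5 => by
      by_contra hne
      exact hno p q h1 h2 h3 h4 (del_adj.2 ⟨h5, hne⟩))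
    ⟨p, fun h => hpS ((hS' p).1 h), (hU' p).2 hpU⟩
    ⟨q, fun h => hqS ((hS' q).1 h), fun h => hqU ((hU' q).1 h)⟩
  rcases hw with rfl | rfl
  · rcases hside with hs | hs
    · exact q.2 (hs q (fun h => hqS ((hS' q).1 h)) (fun h => hqU ((hU' q).1 h)))
    · exact p.2 (hs p (fun h => hpS ((hS' p).1 h)) ((hU' p).2 hpU))
  · omega

/-- Both ends of degree three. -/
lemma conn2 {V : Type*} [Finite V] {G : SimpleGraph V} (hG : Sep G) {a b c : V} {A B : Set V}
    (h : Sep3 G a b c A B) {a1 a2 b1 b2 : V}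
    (hb1 : a1 ≠ b) (hb2 : a2 ≠ b) (h1 : a1 ≠ a) (hadj2 : G.Adj a a2)
    (hN : ∀ y, G.Adj a y → y = b ∨ y = a1 ∨ y = a2)
    (k1 : b1 ≠ a) (k2 : b2 ≠ a) (hadj2' : G.Adj b b2)
    (hN' : ∀ y, G.Adj b y → y = a ∨ y = b1 ∨ y = b2)
    (h2 : (⟨b1, k1⟩ : {w : V // w ≠ a}) ≠ ⟨b, h.ab.symm⟩) :
    Sep (contractGraph (contractGraph (G.deleteEdges {s(a, b)}) h1) h2) := by
  intro S U hS ⟨p, hpS, hpU⟩ ⟨q, hqS, hqU⟩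
  by_contra hcon
  push Not at hcon
  have hab := h.ab
  obtain ⟨S₁, U₁, hSc₁, hS₁, hU₁, hno₁⟩ := lift _ h2 (a2 := ⟨b2, k2⟩)
    (fun h' => hadj2'.ne' (congrArg Subtype.val h'))
    (contract_adj_of _ h1 hab.symm k2
      (del_adj.2 ⟨hadj2', by rw [Ne, Sym2.eq_iff]; tauto⟩))
    (fun y hy => by
      rw [contract_adj] at hy
      obtain ⟨_, r, t, hrt, hr, ht⟩ := hy
      have hrb : r = b := by
        by_cases hra : r = a
        · rw [hra, cf_self] at hr
          exact absurd (congrArg Subtype.val hr) hb1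
        · rw [cf_ne h1 hra] at hr
          exact congrArg Subtype.val hr
      subst hrb
      rw [del_adj] at hrt
      have hta : t ≠ a := by
        rintro rfl
        exact hrt.2 Sym2.eq_swap
      rw [cf_ne h1 hta] at ht
      subst ht
      rcases hN' t hrt.1 with h' | h' | h'
      · exact absurd h' hta
      · exact Or.inl (Subtype.ext h')
      · exact Or.inr (Subtype.ext h')) S U hcon
  obtain ⟨S', U', hSc, hS', hU', hno⟩ := lift (G.deleteEdges {s(a, b)}) h1 hadj2.ne'
    (del_adj.2 ⟨hadj2, by rw [Ne, Sym2.eq_iff]; tauto⟩)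
    (fun y hy => by
      rw [del_adj] at hy
      rcases hN y hy.1 with rfl | h' | h'
      · exact absurd rfl hy.2
      · exact Or.inl h'
      · exact Or.inr h') S₁ U₁ hno₁
  have hpS' : (p : V) ∉ S' := fun h => hpS ((hS₁ p).1 ((hS' p).1 h))
  have hqS' : (q : V) ∉ S' := fun h => hqS ((hS₁ q).1 ((hS' q).1 h))
  have hpU' : (p : V) ∈ U' := (hU' p).2 ((hU₁ p).2 hpU)
  have hqU' : (q : V) ∉ U' := fun h => hqU ((hU₁ q).1 ((hU' q).1 h))
  have hne : ∀ x : {w : {w : V // w ≠ a} // w ≠ ⟨b, h.ab.symm⟩}, ∀ w, (w = a ∨ w = b) →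
      (x : V) ≠ w := by
    rintro x w (rfl | rfl) h'
    · exact x.1.2 h'
    · exact x.2 (Subtype.ext h')
  obtain ⟨w, hw, hd, hside⟩ := key hG h (S := S') (U := U') (by omega)
    (fun p q h1 h2 h3 h4 h5 => by
      by_contra hne
      exact hno p q h1 h2 h3 h4 (del_adj.2 ⟨h5, hne⟩))
    ⟨p, hpS', hpU'⟩ ⟨q, hqS', hqU'⟩
  rcases hside with hs | hs
  · exact hne q w hw (hs q hqS' hqU')
  · exact hne p w hw (hs p hpS' hpU')

/-- An end of degree three of `ab` is not adjacent to `c`. -/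
lemma not_adj_c {V : Type*} [Finite V] {G : SimpleGraph V} (hG : Sep G) {a b c : V} {A B : Set V}
    (h : Sep3 G a b c A B) (hab : G.Adj a b) (ha : vdeg G a = 3) : ¬ G.Adj a c := by
  intro hac
  have hex : ∀ A B, Sep3 G a b c A B → ∃ x ∈ A, G.Adj a x := by
    intro A B h
    obtain ⟨d, hd⟩ := h.neA
    obtain ⟨x, y, hx, hy, hxA, hyA, hadj⟩ := hG {b, c} A (pair_le_two b c)
      ⟨d, by
        rintro (h' | h')
        · exact h.bA (h' ▸ hd)
        · exact h.cA (by rw [← h']; exact hd), hd⟩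
      ⟨a, by
        rintro (h' | h')
        · exact h.ab h'
        · exact h.ac h', h.aA⟩
    refine ⟨x, hxA, ?_⟩
    have hyb : y ≠ b := fun h' => hy (Or.inl h')
    have hyc : y ≠ c := fun h' => hy (Or.inr h')
    have hyB : y ∉ B := fun h' => h.noadj x hxA y h' hadj
    have : y = a := by have := h.cov y; tauto
    rw [← this]; exact hadj.symm
  obtain ⟨x, hx, hax⟩ := hex A B h
  obtain ⟨y, hy, hay⟩ := hex B A h.swap
  obtain ⟨a1, a2, _, _, _, _, _, hN⟩ := nbrs hab ha
  have h1 : c ≠ b := h.bc.symm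
  have h2 : x ≠ b := fun h' => h.bA (h' ▸ hx)
  have h3 : y ≠ b := fun h' => h.bB (h' ▸ hy)
  have h4 : x ≠ c := fun h' => h.cA (h' ▸ hx)
  have h5 : y ≠ c := fun h' => h.cB (h' ▸ hy)
  have h6 : x ≠ y := fun h' => h.disj x hx (h' ▸ hy)
  have e1 := hN c hac
  have e2 := hN x hax
  have e3 := hN y hay
  grind

lemma card_ge_six {V : Type*} [Finite V] {G : SimpleGraph V} (hG : Sep G) {a b c : V}
    {A B : Set V} (h : Sep3 G a b c A B) (hab : G.Adj a b) (ha : vdeg G a = 3)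
    (hb : vdeg G b = 3) : 5 < Nat.card V := by
  by_contra hlt
  have h1 : ({a, b, c} : Set V).ncard = 3 :=
    Set.ncard_eq_three.2 ⟨a, b, c, h.ab, h.ac, h.bc, rfl⟩
  have h2 := Set.ncard_add_ncard_compl ({a, b, c} : Set V)
  obtain ⟨x, y, hx, hy, hxc, hyc, hadj⟩ := hG ({a, b, c}ᶜ) {c} (by omega)
    ⟨c, by simp, rfl⟩ ⟨a, by simp, by simpa using h.ac⟩
  rw [Set.mem_singleton_iff] at hxc hyc
  subst hxc
  have : y = a ∨ y = b ∨ y = x := by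
    by_contra h'
    exact hy h'
  rcases this with rfl | rfl | rfl
  · exact not_adj_c hG h hab ha hadj.symm
  · exact not_adj_c hG h.flip hab.symm hb hadj.symm
  · exact hyc rfl

/-- The two components of `G[X]`, by their vertex sets. -/
structure Comps {V : Type*} (X : Set (Sym2 V)) (K₁ K₂ : Set V) : Prop where
  edge : ∀ x y, s(x, y) ∈ X → x ≠ y → (x ∈ K₁ ∧ y ∈ K₁) ∨ (x ∈ K₂ ∧ y ∈ K₂)
  disj : ∀ x ∈ K₁, x ∉ K₂
  ne₁ : K₁.Nonempty
  ne₂ : K₂.Nonempty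
  ex₁ : ∀ x ∈ K₁, ∃ y, x ≠ y ∧ s(x, y) ∈ X
  ex₂ : ∀ x ∈ K₂, ∃ y, x ≠ y ∧ s(x, y) ∈ X
  reach₁ : ∀ x ∈ K₁, ∀ y ∈ K₁, (fromEdgeSet X).Reachable x y
  reach₂ : ∀ x ∈ K₂, ∀ y ∈ K₂, (fromEdgeSet X).Reachable x y

lemma Comps.swap {V : Type*} {X : Set (Sym2 V)} {K₁ K₂ : Set V} (h : Comps X K₁ K₂) :
    Comps X K₂ K₁ where
  edge := fun x y hx hne => (h.edge x y hx hne).symm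
  disj := fun x hx hx' => h.disj x hx' hx
  ne₁ := h.ne₂
  ne₂ := h.ne₁
  ex₁ := h.ex₂
  ex₂ := h.ex₁
  reach₁ := h.reach₂
  reach₂ := h.reach₁

lemma Comps.inv {V : Type*} {X : Set (Sym2 V)} {K₁ K₂ : Set V} (h : Comps X K₁ K₂)
    {x y : V} (hr : (fromEdgeSet X).Reachable x y) (hx : x ∈ K₁) : y ∈ K₁ := by
  refine reach_inv _ K₁ ?_ hr hx
  intro u v huv hu
  rw [fromEdgeSet_adj] at huv
  rcases h.edge u v huv.1 huv.2 with h' | h'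
  · exact h'.2
  · exact absurd h'.1 (h.disj u hu)

lemma Comps.supp {V : Type*} {X : Set (Sym2 V)} {K₁ K₂ : Set V} (h : Comps X K₁ K₂)
    {x : V} (hx : x ∈ K₁) : x ∈ (fromEdgeSet X).support := by
  obtain ⟨y, hne, hy⟩ := h.ex₁ x hx
  exact ⟨y, (fromEdgeSet_adj X).2 ⟨hy, hne⟩⟩

lemma Comps.joins {V : Type*} {X : Set (Sym2 V)} {K₁ K₂ : Set V} (h : Comps X K₁ K₂)
    {x y : V} (hx : x ∈ K₁) (hy : y ∈ K₂) : JoinsComponents X s(x, y) :=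
  ⟨x, y, rfl, h.supp hx, h.swap.supp hy, fun hr => h.disj y (h.inv hr hx) hy⟩

lemma exists_comps {V : Type*} {X : Set (Sym2 V)} (h : edgeComponents X = 2) :
    ∃ K₁ K₂, Comps X K₁ K₂ := by
  unfold edgeComponents at h
  obtain ⟨c, d, hcd, huniv⟩ := Nat.card_eq_two_iff.1 h
  let K : (edgeSubgraph X).ConnectedComponent → Set V := fun c =>
    {v | ∃ hv : v ∈ (fromEdgeSet X).support, (edgeSubgraph X).connectedComponentMk ⟨v, hv⟩ = c}
  have hne : ∀ c, (K c).Nonempty := by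
    intro c
    induction c using ConnectedComponent.ind with
    | _ v => exact ⟨v, v.2, rfl⟩
  have hex : ∀ c, ∀ x ∈ K c, ∃ y, x ≠ y ∧ s(x, y) ∈ X := by
    rintro c x ⟨⟨y, hy⟩, _⟩
    have hy' := (fromEdgeSet_adj X).1 hy
    exact ⟨y, hy'.2, hy'.1⟩
  have hreach : ∀ c, ∀ x ∈ K c, ∀ y ∈ K c, (fromEdgeSet X).Reachable x y := by
    rintro c x ⟨hx, hx'⟩ y ⟨hy, hy'⟩
    have hr : (edgeSubgraph X).Reachable ⟨x, hx⟩ ⟨y, hy⟩ :=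
      ConnectedComponent.exact (hx'.trans hy'.symm)
    exact hr.map (Embedding.induce (G := fromEdgeSet X) (fromEdgeSet X).support).toHom
  refine ⟨K c, K d, ?_, ?_, hne c, hne d, hex c, hex d, hreach c, hreach d⟩
  · intro x y hxy hne
    have hadj : (fromEdgeSet X).Adj x y := (fromEdgeSet_adj X).2 ⟨hxy, hne⟩
    have hx : x ∈ (fromEdgeSet X).support := ⟨y, hadj⟩
    have hy : y ∈ (fromEdgeSet X).support := ⟨x, hadj.symm⟩
    have hadj' : (edgeSubgraph X).Adj ⟨x, hx⟩ ⟨y, hy⟩ := hadj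
    have heq := ConnectedComponent.sound hadj'.reachable
    have hm : (edgeSubgraph X).connectedComponentMk ⟨x, hx⟩ ∈ ({c, d} : Set _) := by
      rw [huniv]; trivial
    rcases hm with hm | hm
    · exact Or.inl ⟨⟨hx, hm⟩, ⟨hy, heq.symm.trans hm⟩⟩
    · exact Or.inr ⟨⟨hx, hm⟩, ⟨hy, heq.symm.trans hm⟩⟩
  · rintro x ⟨hx, h1⟩ ⟨_, h2⟩
    exact hcd (h1.symm.trans h2)

/-- The constraint after contraction. -/
def contrX {V : Type*} (X : Set (Sym2 V)) {u v : V} (huv : u ≠ v) : Set (Sym2 {w : V // w ≠ v}) :=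
  {e | e ∈ Sym2.map (contractFun huv) '' X ∧ ¬ e.IsDiag}

/-- No edge of `X` crosses `U`. -/
def Spl {V : Type*} (X : Set (Sym2 V)) (U : Set V) : Prop :=
  ∀ x y, s(x, y) ∈ X → x ∈ U → y ∈ U

lemma disc {V : Type*} {X : Set (Sym2 V)} {U : Set V} (h : Spl X U) {x y x' y' : V}
    (hxy : s(x, y) ∈ X) (hne : x ≠ y) (hx : x ∈ U) (hxy' : s(x', y') ∈ X) (hne' : x' ≠ y')
    (hx' : x' ∉ U) : ¬ EdgeSetConnected X := by
  intro hc
  have hr := hc x ⟨y, (fromEdgeSet_adj X).2 ⟨hxy, hne⟩⟩ x' ⟨y', (fromEdgeSet_adj X).2 ⟨hxy', hne'⟩⟩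
  refine hx' (reach_inv _ U ?_ hr hx)
  intro u v huv
  exact h u v ((fromEdgeSet_adj X).1 huv).1

lemma cf_mem {V : Type*} {u v : V} (huv : u ≠ v) {U : Set V} (hU : u ∈ U ↔ v ∈ U) (x : V) :
    (contractFun huv x : V) ∈ U ↔ x ∈ U := by
  by_cases hx : x = v
  · rw [hx, cf_self]; exact hU
  · rw [cf_ne huv hx]

lemma spl_contract {V : Type*} {X : Set (Sym2 V)} {U : Set V} (h : Spl X U) {u v : V}
    (huv : u ≠ v) (hU : u ∈ U ↔ v ∈ U) : Spl (contrX X huv) {x | (x : V) ∈ U} := by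
  rintro x y ⟨⟨e, he, hmap⟩, _⟩ hx
  induction e with
  | _ p q =>
    have hx' : (x : V) ∈ U := hx
    change (y : V) ∈ U
    rw [Sym2.map_mk, Sym2.eq_iff] at hmap
    rcases hmap with ⟨rfl, rfl⟩ | ⟨rfl, rfl⟩
    · rw [cf_mem huv hU] at hx' ⊢
      exact h p q he hx'
    · rw [cf_mem huv hU] at hx' ⊢
      exact h q p (by rw [Sym2.eq_swap]; exact he) hx'

lemma mem_contract {V : Type*} {X : Set (Sym2 V)} {u v : V} (huv : u ≠ v) {p q : V}
    (hpq : s(p, q) ∈ X) (hne : p ≠ q) (hne' : s(p, q) ≠ s(u, v)) :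
    contractFun huv p ≠ contractFun huv q ∧
      s(contractFun huv p, contractFun huv q) ∈ contrX X huv := by
  have hcf : contractFun huv p ≠ contractFun huv q := by
    intro h
    by_cases hp : p = v
    · have hq : q ≠ v := fun h' => hne (hp.trans h'.symm)
      rw [hp, cf_self, cf_ne huv hq] at h
      apply hne'
      have huq : u = q := congrArg Subtype.val h
      rw [hp, ← huq, Sym2.eq_swap]
    · by_cases hq : q = v
      · rw [hq, cf_self, cf_ne huv hp] at h
        apply hne'
        have hpu : p = u := congrArg Subtype.val h
        rw [hq, hpu]
      · rw [cf_ne huv hp, cf_ne huv hq] at h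
        exact hne (congrArg Subtype.val h)
  exact ⟨hcf, ⟨s(p, q), hpq, rfl⟩, by simpa using hcf⟩

lemma Comps.edge₂ {V : Type*} {X : Set (Sym2 V)} {K₁ K₂ : Set V} (h : Comps X K₁ K₂) :
    ∃ x y, x ≠ y ∧ s(x, y) ∈ X ∧ x ∈ K₂ ∧ y ∈ K₂ := by
  obtain ⟨x, hx⟩ := h.ne₂
  obtain ⟨y, hne, hxy⟩ := h.ex₂ x hx
  rcases h.edge x y hxy hne with h' | h'
  · exact absurd hx (h.disj x h'.1)
  · exact ⟨x, y, hne, hxy, h'.1, h'.2⟩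

lemma good1 {V : Type*} {X : Set (Sym2 V)} {K₁ K₂ : Set V} (h : Comps X K₁ K₂)
    (hl : ∀ x y, s(x, y) ∈ X → x ≠ y) {a a' : V} (ha : a ∉ K₂) (h1 : a' ≠ a)
    (hg : a ∈ K₁ → a' ∉ K₂) {p q : V} (hpq : s(p, q) ∈ X) (hp : p ∈ K₁)
    (hne : s(p, q) ≠ s(a', a)) : ¬ EdgeSetConnected (contrX X h1) := by
  let U : Set V := {x | x ∉ K₂ ∧ ¬ (x = a ∧ a' ∈ K₂)}
  have hspl : Spl X U := by
    rintro x y hxy ⟨hx, hx'⟩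
    refine ⟨?_, ?_⟩
    · rcases h.edge x y hxy (hl x y hxy) with h' | h'
      · exact h.disj y h'.2
      · exact absurd h'.1 hx
    · rintro ⟨rfl, hy⟩
      rcases h.edge x y hxy (hl x y hxy) with h' | h'
      · exact hg h'.2 hy
      · exact hx h'.1
  have hU : a' ∈ U ↔ a ∈ U := by
    constructor
    · rintro ⟨h3, h4⟩
      exact ⟨ha, fun h' => h3 h'.2⟩
    · rintro ⟨h3, h4⟩
      exact ⟨fun h' => h4 ⟨rfl, h'⟩, fun h' => h1 h'.1⟩
  obtain ⟨x, y, hxy, hX, hx, hy⟩ := h.edge₂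
  have m1 := mem_contract h1 hpq (hl _ _ hpq) hne
  have m2 := mem_contract h1 hX hxy (by
    rw [Ne, Sym2.eq_iff]
    rintro (⟨_, h'⟩ | ⟨h', _⟩)
    · exact ha (h' ▸ hy)
    · exact ha (h' ▸ hx))
  refine disc (spl_contract hspl h1 hU) m1.2 m1.1 ?_ m2.2 m2.1 ?_
  · change ((contractFun h1 p : {w : V // w ≠ a}) : V) ∈ U
    rw [cf_mem h1 hU]
    refine ⟨h.disj p hp, ?_⟩
    rintro ⟨rfl, h'⟩
    exact hg hp h'
  · change ((contractFun h1 x : {w : V // w ≠ a}) : V) ∉ U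
    rw [cf_mem h1 hU]
    exact fun h' => h'.1 hx

lemma good2 {V : Type*} {X : Set (Sym2 V)} {K₁ K₂ : Set V} (h : Comps X K₁ K₂)
    (hl : ∀ x y, s(x, y) ∈ X → x ≠ y) {a a' b b' : V} (hab : a ≠ b) (habX : s(a, b) ∉ X)
    (ha : a ∉ K₂) (hb : b ∉ K₂) (h1 : a' ≠ a) (hab' : a' ≠ b) (hba' : b' ≠ a)
    (hb' : b' ≠ b) (h2 : (⟨b', hba'⟩ : {w : V // w ≠ a}) ≠ ⟨b, hab.symm⟩)
    (hg : a ∈ K₁ → a' ∉ K₂) (hg' : b ∈ K₁ → b' ∉ K₂) {p q : V} (hpq : s(p, q) ∈ X)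
    (hp : p ∈ K₁) (hne : s(p, q) ≠ s(a', a)) (hne' : s(p, q) ≠ s(b', b)) :
    ¬ EdgeSetConnected (contrX (contrX X h1) h2) := by
  let U : Set V := {x | x ∉ K₂ ∧ ¬ (x = a ∧ a' ∈ K₂) ∧ ¬ (x = b ∧ b' ∈ K₂)}
  have hspl : Spl X U := by
    rintro x y hxy ⟨hx, hx'⟩
    refine ⟨?_, ?_, ?_⟩
    · rcases h.edge x y hxy (hl x y hxy) with h' | h'
      · exact h.disj y h'.2
      · exact absurd h'.1 hx
    · rintro ⟨rfl, hy⟩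
      rcases h.edge x y hxy (hl x y hxy) with h' | h'
      · exact hg h'.2 hy
      · exact hx h'.1
    · rintro ⟨rfl, hy⟩
      rcases h.edge x y hxy (hl x y hxy) with h' | h'
      · exact hg' h'.2 hy
      · exact hx h'.1
  have hU : a' ∈ U ↔ a ∈ U := by
    constructor
    · rintro ⟨h3, _⟩
      exact ⟨ha, fun h' => h3 h'.2, fun h' => hab h'.1⟩
    · rintro ⟨_, h4, _⟩
      exact ⟨fun h' => h4 ⟨rfl, h'⟩, fun h' => h1 h'.1, fun h' => hab' h'.1⟩
  have hUb : b' ∈ U ↔ b ∈ U := by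
    constructor
    · rintro ⟨h3, _⟩
      exact ⟨hb, fun h' => hab h'.1.symm, fun h' => h3 h'.2⟩
    · rintro ⟨_, _, h4⟩
      exact ⟨fun h' => h4 ⟨rfl, h'⟩, fun h' => hba' h'.1, fun h' => hb' h'.1⟩
  have hU2 : (⟨b', hba'⟩ : {w : V // w ≠ a}) ∈ {x : {w : V // w ≠ a} | (x : V) ∈ U} ↔
      (⟨b, hab.symm⟩ : {w : V // w ≠ a}) ∈ {x : {w : V // w ≠ a} | (x : V) ∈ U} := hUb
  -- an edge surviving the first contraction and different from `bb'` survives the second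
  have surv : ∀ p q, s(p, q) ∈ X → s(p, q) ≠ s(b', b) →
      s(contractFun h1 p, contractFun h1 q) ≠
        s((⟨b', hba'⟩ : {w : V // w ≠ a}), (⟨b, hab.symm⟩ : {w : V // w ≠ a})) := by
    have aux : ∀ p q, s(p, q) ∈ X → s(p, q) ≠ s(b', b) →
        contractFun h1 p = ⟨b', hba'⟩ → contractFun h1 q = ⟨b, hab.symm⟩ → False := by
      intro p q hpq hne hp hq
      have hqb : q = b := by
        by_cases hqa : q = a
        · rw [hqa, cf_self] at hq
          exact absurd (congrArg Subtype.val hq) hab'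
        · rw [cf_ne h1 hqa] at hq
          exact congrArg Subtype.val hq
      by_cases hpa : p = a
      · rw [hpa, hqb] at hpq
        exact habX hpq
      · rw [cf_ne h1 hpa] at hp
        apply hne
        have hpb : p = b' := congrArg Subtype.val hp
        rw [hqb, hpb]
    intro p q hpq hne heq
    rw [Sym2.eq_iff] at heq
    rcases heq with h' | h'
    · exact aux p q hpq hne h'.1 h'.2
    · exact aux q p (by rw [Sym2.eq_swap]; exact hpq) (by rw [Sym2.eq_swap]; exact hne) h'.2 h'.1
  obtain ⟨x, y, hxy, hX, hx, hy⟩ := h.edge₂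
  have m1 := mem_contract h1 hpq (hl _ _ hpq) hne
  have m2 := mem_contract h1 hX hxy (by
    rw [Ne, Sym2.eq_iff]
    rintro (⟨_, h'⟩ | ⟨h', _⟩)
    · exact ha (h' ▸ hy)
    · exact ha (h' ▸ hx))
  have n1 := mem_contract h2 m1.2 m1.1 (surv p q hpq hne')
  have n2 := mem_contract h2 m2.2 m2.1 (surv x y hX (by
    rw [Ne, Sym2.eq_iff]
    rintro (⟨_, h'⟩ | ⟨h', _⟩)
    · exact hb (h' ▸ hy)
    · exact hb (h' ▸ hx)))
  refine disc (spl_contract (spl_contract hspl h1 hU) h2 hU2) n1.2 n1.1 ?_ n2.2 n2.1 ?_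
  · rw [Set.mem_ofPred_eq, cf_mem h2 hU2, Set.mem_ofPred_eq, cf_mem h1 hU]
    refine ⟨h.disj p hp, ?_, ?_⟩
    · rintro ⟨rfl, h'⟩
      exact hg hp h'
    · rintro ⟨rfl, h'⟩
      exact hg' hp h'
  · rw [Set.mem_ofPred_eq, cf_mem h2 hU2, Set.mem_ofPred_eq, cf_mem h1 hU]
    exact fun h' => h'.1 hx

/-- The last two alternatives of the theorem. -/
def Concl {V : Type*} (G : SimpleGraph V) (X : Set (Sym2 V)) (e : Sym2 V) : Prop :=
    (∃ f, SingleEdgeComponent X f ∧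
      ∃ v ∈ e, v ∈ f ∧ vdeg G v = 3 ∧
        ∃ w, G.Adj v w ∧ s(v, w) ≠ e ∧ s(v, w) ≠ f ∧ JoinsComponents X s(v, w)) ∨
    (∃ v₁ v₂ z : V, e = s(v₁, v₂) ∧ s(v₁, z) ∈ X ∧ s(v₂, z) ∈ X ∧
      s(v₁, z) ≠ s(v₂, z) ∧
      (∀ g ∈ X, (∃ b ∈ g, (fromEdgeSet X).Reachable b z) →
        g = s(v₁, z) ∨ g = s(v₂, z)) ∧
      vdeg G v₁ = 3 ∧ vdeg G v₂ = 3 ∧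
      (∀ i ∈ ({v₁, v₂} : Set V),
        ∃ w, G.Adj i w ∧ s(i, w) ≠ e ∧ JoinsComponents X s(i, w)))

lemma edge_in_K {V : Type*} {X : Set (Sym2 V)} {K₁ K₂ : Set V} (h : Comps X K₁ K₂)
    (hl : ∀ x y, s(x, y) ∈ X → x ≠ y) {Q : Sym2 V → Prop}
    (hC : ∀ p q, s(p, q) ∈ X → p ∈ K₁ → Q s(p, q)) {g : Sym2 V} (hg : g ∈ X) {x z : V}
    (hx : x ∈ g) (hz : z ∈ K₁) (hr : (fromEdgeSet X).Reachable x z) : Q g := by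
  have hxK := h.inv hr.symm hz
  induction g with
  | _ p q =>
    rcases Sym2.mem_iff.1 hx with rfl | rfl
    · exact hC _ _ hg hxK
    · rw [Sym2.eq_swap] at hg ⊢
      exact hC _ _ hg hxK

lemma concl2 {V : Type*} {G : SimpleGraph V} {X : Set (Sym2 V)} {K₁ K₂ : Set V}
    (h : Comps X K₁ K₂) (hl : ∀ x y, s(x, y) ∈ X → x ≠ y) {e : Sym2 V} {a b a1 a2 : V}
    (he : e = s(a, b)) (haK : a ∈ K₁)
    (ha1 : s(a, a1) ∈ X) (ha2 : a2 ∈ K₂) (hadj : G.Adj a a2) (h2b : a2 ≠ b) (h12 : a1 ≠ a2)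
    (hd : vdeg G a = 3) (hC : ∀ p q, s(p, q) ∈ X → p ∈ K₁ → s(p, q) = s(a, a1)) :
    Concl G X e := by
  left
  have ha1K : a1 ∈ K₁ := by
    rcases h.edge _ _ ha1 (hl _ _ ha1) with h' | h'
    · exact h'.2
    · exact absurd h'.1 (h.disj a haK)
  refine ⟨s(a, a1), ⟨ha1, ?_⟩, a, by rw [he]; exact Sym2.mem_mk_left _ _, Sym2.mem_mk_left _ _,
    hd, a2, hadj, ?_, ?_, h.joins haK ha2⟩
  · rintro g hg ⟨x, hx, y, hy, hr⟩
    have hxK : x ∈ K₁ := by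
      rcases Sym2.mem_iff.1 hx with rfl | rfl
      · exact haK
      · exact ha1K
    exact edge_in_K h hl (Q := fun g => g = s(a, a1)) hC hg hy hxK hr.symm
  · rw [he, Ne, Sym2.eq_iff]
    have := hadj.ne'
    tauto
  · rw [Ne, Sym2.eq_iff]
    have := hadj.ne'
    grind

/-- A vertex of `K₁` of degree three has a constraint edge different from `ab`. -/
lemma onX {V : Type*} {G : SimpleGraph V} {X : Set (Sym2 V)} {K₁ K₂ : Set V}
    (h : Comps X K₁ K₂) (hX : X ⊆ G.edgeSet) {a b a1 a2 : V} (habX : s(a, b) ∉ X)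
    (hN : ∀ y, G.Adj a y → y = b ∨ y = a1 ∨ y = a2) (haK : a ∈ K₁) :
    ∃ x y, ((x = a1 ∧ y = a2) ∨ (x = a2 ∧ y = a1)) ∧ s(a, x) ∈ X ∧ x ∉ K₂ := by
  obtain ⟨y, hne, hy⟩ := h.ex₁ a haK
  have hyK : y ∉ K₂ := by
    rcases h.edge _ _ hy hne with h' | h'
    · exact h.disj _ h'.2
    · exact absurd h'.1 (h.disj a haK)
  rcases hN y (hX hy) with rfl | rfl | rfl
  · exact absurd hy habX
  · exact ⟨y, a2, Or.inl ⟨rfl, rfl⟩, hy, hyK⟩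
  · exact ⟨y, a1, Or.inr ⟨rfl, rfl⟩, hy, hyK⟩

/-- The bookkeeping when exactly one vertex is suppressed. -/
lemma core1 {V : Type*} {G : SimpleGraph V} {X : Set (Sym2 V)} {K₁ K₂ : Set V}
    (h : Comps X K₁ K₂) (hX : X ⊆ G.edgeSet) (hl : ∀ x y, s(x, y) ∈ X → x ≠ y)
    {e : Sym2 V} {a b a1 a2 : V}
    (he : e = s(a, b)) (habX : s(a, b) ∉ X) (hd : vdeg G a = 3) (h12 : a1 ≠ a2)
    (h1b : a1 ≠ b) (h2b : a2 ≠ b) (had1 : G.Adj a a1) (had2 : G.Adj a a2)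
    (hN : ∀ y, G.Adj a y → y = b ∨ y = a1 ∨ y = a2)
    (hB : ∀ a', (a' = a1 ∨ a' = a2) → (a ∈ K₁ ∧ a' ∈ K₂) ∨
      ∀ p q, s(p, q) ∈ X → p ∈ K₁ → s(p, q) = s(a', a)) : Concl G X e := by
  obtain ⟨p, q, hpqne, hpq, hp, hq⟩ := h.swap.edge₂
  by_cases haK : a ∈ K₁
  · obtain ⟨x, y, hxy, hxX, hxK⟩ := onX h hX habX hN haK
    have hx : ∀ p q, s(p, q) ∈ X → p ∈ K₁ → s(p, q) = s(x, a) := by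
      rcases hB x (by tauto) with h' | h'
      · exact absurd h'.2 hxK
      · exact h'
    have hyx : x ≠ y := by grind
    have hy : y ∈ K₂ := by
      rcases hB y (by tauto) with h' | h'
      · exact h'.2
      · have e1 := h' a x hxX haK
        rw [Sym2.eq_iff] at e1
        have := hl _ _ hxX
        grind
    refine concl2 h hl he haK hxX hy ?_ ?_ hyx hd ?_
    · rcases hxy with ⟨_, rfl⟩ | ⟨_, rfl⟩ <;> assumption
    · rcases hxy with ⟨_, rfl⟩ | ⟨_, rfl⟩ <;> assumption
    · intro p q hpq hp
      rw [hx p q hpq hp, Sym2.eq_swap]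
  · exfalso
    rcases hB a1 (Or.inl rfl) with h' | h'
    · exact haK h'.1
    · have e1 := h' p q hpq hp
      rw [Sym2.eq_iff] at e1
      grind

/-- The bookkeeping when two vertices are suppressed, `a` not covered by `K₁`. -/
lemma core2a {V : Type*} {G : SimpleGraph V} {X : Set (Sym2 V)} {K₁ K₂ : Set V}
    (h : Comps X K₁ K₂) (hX : X ⊆ G.edgeSet) (hl : ∀ x y, s(x, y) ∈ X → x ≠ y)
    {e : Sym2 V} {a b a1 a2 b1 b2 : V}
    (he : e = s(a, b)) (habX : s(a, b) ∉ X) (hd' : vdeg G b = 3)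
    (k12 : b1 ≠ b2) (k1a : b1 ≠ a) (k2a : b2 ≠ a) (bad1 : G.Adj b b1) (bad2 : G.Adj b b2)
    (hN' : ∀ y, G.Adj b y → y = a ∨ y = b1 ∨ y = b2)
    (hB : ∀ a' b', (a' = a1 ∨ a' = a2) → (b' = b1 ∨ b' = b2) → (a ∈ K₁ ∧ a' ∈ K₂) ∨
      (b ∈ K₁ ∧ b' ∈ K₂) ∨
      ∀ p q, s(p, q) ∈ X → p ∈ K₁ → s(p, q) = s(a', a) ∨ s(p, q) = s(b', b))
    (haK : a ∉ K₁) : Concl G X e := by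
  refine core1 h hX hl (a := b) (b := a) (by rw [he, Sym2.eq_swap])
    (by rw [Sym2.eq_swap]; exact habX) hd' k12 k1a k2a bad1 bad2 hN' ?_
  intro b' hb'
  rcases hB a1 b' (Or.inl rfl) hb' with h' | h' | h'
  · exact absurd h'.1 haK
  · exact Or.inl h'
  · right
    intro p q hpq hp
    rcases h' p q hpq hp with h'' | h''
    · exfalso
      have hq : q ∈ K₁ := by
        rcases h.edge _ _ hpq (hl _ _ hpq) with h3 | h3
        · exact h3.2
        · exact absurd h3.1 (h.disj p hp)
      rw [Sym2.eq_iff] at h''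
      grind
    · exact h''

lemma core2 {V : Type*} {G : SimpleGraph V} {X : Set (Sym2 V)} {K₁ K₂ : Set V}
    (h : Comps X K₁ K₂) (hX : X ⊆ G.edgeSet) (hl : ∀ x y, s(x, y) ∈ X → x ≠ y)
    {e : Sym2 V} {a b a1 a2 b1 b2 : V} (hab : a ≠ b)
    (he : e = s(a, b)) (habX : s(a, b) ∉ X) (hd : vdeg G a = 3) (h12 : a1 ≠ a2)
    (h1b : a1 ≠ b) (h2b : a2 ≠ b) (had1 : G.Adj a a1) (had2 : G.Adj a a2)
    (hN : ∀ y, G.Adj a y → y = b ∨ y = a1 ∨ y = a2) (hd' : vdeg G b = 3)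
    (k12 : b1 ≠ b2) (k1a : b1 ≠ a) (k2a : b2 ≠ a) (bad1 : G.Adj b b1) (bad2 : G.Adj b b2)
    (hN' : ∀ y, G.Adj b y → y = a ∨ y = b1 ∨ y = b2)
    (hB : ∀ a' b', (a' = a1 ∨ a' = a2) → (b' = b1 ∨ b' = b2) → (a ∈ K₁ ∧ a' ∈ K₂) ∨
      (b ∈ K₁ ∧ b' ∈ K₂) ∨
      ∀ p q, s(p, q) ∈ X → p ∈ K₁ → s(p, q) = s(a', a) ∨ s(p, q) = s(b', b)) :
    Concl G X e := by
  have hbaX : s(b, a) ∉ X := by rw [Sym2.eq_swap]; exact habX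
  by_cases haK : a ∈ K₁
  swap
  · exact core2a h hX hl he habX hd' k12 k1a k2a bad1 bad2 hN' hB haK
  by_cases hbK : b ∈ K₁
  swap
  · refine core2a (a1 := b1) (a2 := b2) h hX hl (a := b) (b := a) (by rw [he, Sym2.eq_swap])
      hbaX hd h12 h1b h2b had1 had2 hN ?_ hbK
    intro b' a' hb' ha'
    rcases hB a' b' ha' hb' with h' | h' | h'
    · exact Or.inr (Or.inl h')
    · exact Or.inl h'
    · exact Or.inr (Or.inr fun p q hpq hp => (h' p q hpq hp).symm)
  obtain ⟨x, y, hxy, hxX, hxK⟩ := onX h hX habX hN haK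
  obtain ⟨u, v, huv, huX, huK⟩ := onX h hX hbaX hN' hbK
  have hC : ∀ p q, s(p, q) ∈ X → p ∈ K₁ → s(p, q) = s(x, a) ∨ s(p, q) = s(u, b) := by
    rcases hB x u (by tauto) (by tauto) with h' | h' | h'
    · exact absurd h'.2 hxK
    · exact absurd h'.2 huK
    · exact h'
  have hxb : x ≠ b := by grind
  have hua : u ≠ a := by grind
  have hxa : a ≠ x := hl _ _ hxX
  have hub : b ≠ u := hl _ _ huX
  have hxyne : x ≠ y := by grind
  have huvne : u ≠ v := by grind
  have hyb : y ≠ b := by grind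
  have hva : v ≠ a := by grind
  have hay : G.Adj a y := by
    rcases hxy with ⟨_, rfl⟩ | ⟨_, rfl⟩ <;> assumption
  have hbv : G.Adj b v := by
    rcases huv with ⟨_, rfl⟩ | ⟨_, rfl⟩ <;> assumption
  have hyK : y ∈ K₂ := by
    rcases hB y u (by tauto) (by tauto) with h' | h' | h'
    · exact h'.2
    · exact absurd h'.2 huK
    · have e1 := h' a x hxX haK
      rw [Sym2.eq_iff, Sym2.eq_iff] at e1
      grind
  have hvK : v ∈ K₂ := by
    rcases hB x v (by tauto) (by tauto) with h' | h' | h'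
    · exact absurd h'.2 hxK
    · exact h'.2
    · have e1 := h' b u huX hbK
      rw [Sym2.eq_iff, Sym2.eq_iff] at e1
      grind
  have hxu : x = u := by
    by_contra hne
    have hr := h.reach₁ a haK b hbK
    have hb : b ∈ ({a, x} : Set V) := by
      refine reach_inv _ {a, x} ?_ hr (Or.inl rfl)
      intro p q hpq hp
      have hpq' := (fromEdgeSet_adj X).1 hpq
      have hxK₁ : x ∈ K₁ := by
        rcases h.edge _ _ hxX hxa with h3 | h3
        · exact h3.2
        · exact absurd h3.1 (h.disj a haK)
      have hpK : p ∈ K₁ := by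
        rcases hp with rfl | hp
        · exact haK
        · rw [Set.mem_singleton_iff.1 hp]; exact hxK₁
      have e1 := hC p q hpq'.1 hpK
      rw [Sym2.eq_iff, Sym2.eq_iff] at e1
      simp only [Set.mem_insert_iff, Set.mem_singleton_iff] at hp ⊢
      grind
    rcases hb with hb | hb
    · exact hab hb.symm
    · exact hxb hb.symm
  subst hxu
  right
  have hxK₁ : x ∈ K₁ := by
    rcases h.edge _ _ hxX hxa with h3 | h3
    · exact h3.2
    · exact absurd h3.1 (h.disj a haK)
  refine ⟨a, b, x, he, hxX, huX, ?_, ?_, hd, hd', ?_⟩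
  · rw [Ne, Sym2.eq_iff]
    grind
  · rintro g hg ⟨w, hw, hr⟩
    refine edge_in_K h hl (Q := fun g => g = s(a, x) ∨ g = s(b, x)) ?_ hg hw hxK₁ hr
    intro p q hpq hp
    rw [Sym2.eq_swap (a := a), Sym2.eq_swap (a := b)]
    exact hC p q hpq hp
  · rintro i (rfl | hi)
    · refine ⟨y, hay, ?_, h.joins haK hyK⟩
      rw [he, Ne, Sym2.eq_iff]
      grind
    · rw [Set.mem_singleton_iff.1 hi]
      refine ⟨v, hbv, ?_, h.joins hbK hvK⟩
      rw [he, Ne, Sym2.eq_iff]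
      grind

lemma card_ge_five {V : Type*} [Finite V] {X : Set (Sym2 V)} {K₁ K₂ : Set V}
    (h : Comps X K₁ K₂) {a b : V} (hab : a ≠ b) (habX : s(a, b) ∉ X)
    (ha : a ∉ K₂) (hb : b ∉ K₂) : 4 < Nat.card V := by
  obtain ⟨x, y, hxy, hX, hx, hy⟩ := h.edge₂
  obtain ⟨p, q, hpq, hpqX, hp, hq⟩ := h.swap.edge₂
  obtain ⟨r, hr, hra, hrb⟩ : ∃ r, r ∈ K₁ ∧ r ≠ a ∧ r ≠ b := by
    by_contra hcon
    push Not at hcon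
    have h1 := hcon p hp
    have h2 := hcon q hq
    by_cases hpa : p = a
    · by_cases hqa : q = a
      · exact hpq (hpa.trans hqa.symm)
      · rw [hpa, h2 hqa] at hpqX
        exact habX hpqX
    · by_cases hqa : q = a
      · rw [hqa, h1 hpa, Sym2.eq_swap] at hpqX
        exact habX hpqX
      · exact hpq ((h1 hpa).trans (h2 hqa).symm)
  have hrx : r ≠ x := fun h' => h.disj r hr (h' ▸ hx)
  have hry : r ≠ y := fun h' => h.disj r hr (h' ▸ hy)
  have hax : a ≠ x := fun h' => ha (h' ▸ hx)
  have hay : a ≠ y := fun h' => ha (h' ▸ hy)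
  have hbx : b ≠ x := fun h' => hb (h' ▸ hx)
  have hby : b ≠ y := fun h' => hb (h' ▸ hy)
  have h1 : ({x, y} : Set V).ncard = 2 := Set.ncard_pair hxy
  have h2 : ({r, x, y} : Set V).ncard = 3 := by
    rw [Set.ncard_insert_of_notMem (by simp [hrx, hry]), h1]
  have h3 : ({b, r, x, y} : Set V).ncard = 4 := by
    rw [Set.ncard_insert_of_notMem (by simp [hrb.symm, hbx, hby]), h2]
  have h4 : ({a, b, r, x, y} : Set V).ncard = 5 := by
    rw [Set.ncard_insert_of_notMem (by simp [hab, hra.symm, hax, hay]), h3]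
  have := Set.ncard_le_card ({a, b, r, x, y} : Set V)
  omega

/-- One end of degree three, the other of larger degree. -/
lemma case1 (C : CGraph) (hWF : C.WF) (hG : Sep C.G) (hl : ∀ x y, s(x, y) ∈ C.X → x ≠ y)
    {K₁ K₂ : Set C.V} (h : Comps C.X K₁ K₂) {a b c : C.V} {A B : Set C.V}
    (hs : Sep3 C.G a b c A B) (hab : C.G.Adj a b) (habX : s(a, b) ∉ C.X) (ha : a ∉ K₂)
    (hcard : 4 < Nat.card C.V)
    (hda : vdeg C.G a = 3) (hdb : 3 < vdeg C.G b)
    (hess : ¬ BadMinor (C.deleteEdge s(a, b))) : Concl C.G C.X s(a, b) := by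
  obtain ⟨a1, a2, h12, h1b, h2b, had1, had2, hN⟩ := nbrs hab hda
  have main : ∀ x y, x ≠ b → y ≠ b → C.G.Adj a x → C.G.Adj a y →
      (∀ w, C.G.Adj a w → w = b ∨ w = x ∨ w = y) → (a ∈ K₁ ∧ x ∈ K₂) ∨
      ∀ p q, s(p, q) ∈ C.X → p ∈ K₁ → s(p, q) = s(x, a) := by
    intro x y hxb hyb hax hay hN
    by_contra hcon
    push Not at hcon
    obtain ⟨hc1, p, q, hpq, hp, hne⟩ := hcon
    have hstep : (C.deleteEdge s(a, b)).G.Adj x a := by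
      have hne' : s(x, a) ≠ s(a, b) := by
        rw [Ne, Sym2.eq_iff]
        have := hab.ne
        have := hax.ne
        grind
      exact del_adj.2 ⟨hax.symm, hne'⟩
    apply hess
    refine ⟨_, Relation.ReflTransGen.single (CMinorStep.contr (C.deleteEdge s(a, b)) x a hstep), ?_, ?_⟩
    · refine kconn_of_sep ?_ (conn1 hG hs hdb hyb hax.ne' hay hN)
      have h5 := card_contract a
      change 3 < Nat.card {w : C.V // w ≠ a}
      omega
    · exact good1 h hl ha hax.ne' hc1 hpq hp hne
  refine core1 h hWF hl rfl habX hda h12 h1b h2b had1 had2 hN ?_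
  rintro a' (rfl | rfl)
  · exact main _ a2 h1b h2b had1 had2 hN
  · exact main _ a1 h2b h1b had2 had1 (fun w hw => by have := hN w hw; tauto)

/-- Both ends of degree three. -/
lemma case2 (C : CGraph) (hWF : C.WF) (hG : Sep C.G) (hl : ∀ x y, s(x, y) ∈ C.X → x ≠ y)
    {K₁ K₂ : Set C.V} (h : Comps C.X K₁ K₂) {a b c : C.V} {A B : Set C.V}
    (hs : Sep3 C.G a b c A B) (hab : C.G.Adj a b) (habX : s(a, b) ∉ C.X) (ha : a ∉ K₂)
    (hb : b ∉ K₂) (hda : vdeg C.G a = 3) (hdb : vdeg C.G b = 3)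
    (hess : ¬ BadMinor (C.deleteEdge s(a, b))) : Concl C.G C.X s(a, b) := by
  have hcard := card_ge_six hG hs hab hda hdb
  obtain ⟨a1, a2, h12, h1b, h2b, had1, had2, hN⟩ := nbrs hab hda
  obtain ⟨b1, b2, k12, k1a, k2a, bad1, bad2, hN'⟩ := nbrs hab.symm hdb
  have main : ∀ x y, x ≠ b → y ≠ b → C.G.Adj a x → C.G.Adj a y →
      (∀ w, C.G.Adj a w → w = b ∨ w = x ∨ w = y) →
      ∀ u v, u ≠ a → v ≠ a → C.G.Adj b u → C.G.Adj b v →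
      (∀ w, C.G.Adj b w → w = a ∨ w = u ∨ w = v) →
      (a ∈ K₁ ∧ x ∈ K₂) ∨ (b ∈ K₁ ∧ u ∈ K₂) ∨
      ∀ p q, s(p, q) ∈ C.X → p ∈ K₁ → s(p, q) = s(x, a) ∨ s(p, q) = s(u, b) := by
    intro x y hxb hyb hax hay hN u v hua hva hbu hbv hN'
    by_contra hcon
    push Not at hcon
    obtain ⟨hc1, hc2, p, q, hpq, hp, hne1, hne2⟩ := hcon
    have hstep : (C.deleteEdge s(a, b)).G.Adj x a := by
      have hne' : s(x, a) ≠ s(a, b) := by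
        rw [Ne, Sym2.eq_iff]
        have := hab.ne
        have := hax.ne
        grind
      exact del_adj.2 ⟨hax.symm, hne'⟩
    have hubD : (C.deleteEdge s(a, b)).G.Adj u b := by
      have hne' : s(u, b) ≠ s(a, b) := by
        rw [Ne, Sym2.eq_iff]
        have := hab.ne
        have := hbu.ne
        grind
      exact del_adj.2 ⟨hbu.symm, hne'⟩
    have hstep2 : ((C.deleteEdge s(a, b)).contract x a hstep.ne).G.Adj
        (⟨u, hua⟩ : {w : C.V // w ≠ a}) (⟨b, hab.ne'⟩ : {w : C.V // w ≠ a}) :=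
      contract_adj_of _ hstep.ne hua hab.ne' hubD
    apply hess
    refine ⟨_, (Relation.ReflTransGen.single (CMinorStep.contr (C.deleteEdge s(a, b)) x a hstep)).tail
      (CMinorStep.contr ((C.deleteEdge s(a, b)).contract x a hstep.ne) _ _ hstep2), ?_, ?_⟩
    · refine kconn_of_sep ?_ (conn2 hG hs hxb hyb hax.ne' hay hN hua hva hbv hN' hstep2.ne)
      have h5 := card_contract a
      have h6 := card_contract (⟨b, hab.ne'⟩ : {w : C.V // w ≠ a})
      change 3 < Nat.card {w : {w : C.V // w ≠ a} // w ≠ ⟨b, hab.ne'⟩}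
      omega
    · exact good2 h hl hab.ne habX ha hb hax.ne' hxb hua hbu.ne' hstep2.ne hc1 hc2 hpq hp
        hne1 hne2
  have swN : ∀ w, C.G.Adj a w → w = b ∨ w = a2 ∨ w = a1 := fun w hw => by
    have := hN w hw; tauto
  have swN' : ∀ w, C.G.Adj b w → w = a ∨ w = b2 ∨ w = b1 := fun w hw => by
    have := hN' w hw; tauto
  refine core2 h hWF hl hab.ne rfl habX hda h12 h1b h2b had1 had2 hN hdb k12 k1a k2a bad1 bad2
    hN' ?_
  rintro a' b' (rfl | rfl) (rfl | rfl)
  · exact main _ a2 h1b h2b had1 had2 hN _ b2 k1a k2a bad1 bad2 hN'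
  · exact main _ a2 h1b h2b had1 had2 hN _ b1 k2a k1a bad2 bad1 swN'
  · exact main _ a1 h2b h1b had2 had1 swN _ b2 k1a k2a bad1 bad2 hN'
  · exact main _ a1 h2b h1b had2 had1 swN _ b1 k2a k1a bad2 bad1 swN'

lemma main_aux (C : CGraph) (hWF : C.WF) (h3 : KConnected 3 C.G)
    {K₁ K₂ : Set C.V} (h : Comps C.X K₁ K₂) {a b : C.V}
    (hab : C.G.Adj a b) (habX : s(a, b) ∉ C.X) (ha : a ∉ K₂)
    (hb : b ∉ K₂) (hess : Essential C s(a, b)) : Concl C.G C.X s(a, b) := by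
  have hG := sep_of_kconn h3
  have hl : ∀ x y, s(x, y) ∈ C.X → x ≠ y := fun x y hxy => by
    have h' : C.G.Adj x y := hWF hxy
    exact h'.ne
  have hcard := card_ge_five h hab.ne habX ha hb
  obtain ⟨p, q, hpqne, hpq, hp, hq⟩ := h.swap.edge₂
  have hnS : ¬ Sep (contractGraph C.G hab.ne) := by
    intro hS
    apply hess.2 a b hab rfl
    refine ⟨_, Relation.ReflTransGen.refl, kconn_of_sep ?_ hS, ?_⟩
    · have h5 := card_contract b
      change 3 < Nat.card {w : C.V // w ≠ b}
      omega
    · exact good1 h hl hb hab.ne (fun _ => ha) hpq hp (fun h' => habX (h' ▸ hpq))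
  obtain ⟨c, A, B, hs⟩ := exists_sep3 hG hab.ne hnS
  have hda := three_le_deg hG h3.1 a
  have hdb := three_le_deg hG h3.1 b
  rcases hda.eq_or_lt with hda | hda
  · rcases hdb.eq_or_lt with hdb | hdb
    · exact case2 C hWF hG hl h hs hab habX ha hb hda.symm hdb.symm hess.1
    · exact case1 C hWF hG hl h hs hab habX ha hcard hda.symm hdb hess.1
  · rcases hdb.eq_or_lt with hdb | hdb
    · have hsw : s(a, b) = s(b, a) := Sym2.eq_swap
      rw [hsw] at habX ⊢
      have h1 := hess.1
      rw [hsw] at h1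
      exact case1 C hWF hG hl h hs.flip hab.symm habX hb hcard hdb.symm hda h1
    · exfalso
      apply hess.1
      refine ⟨_, Relation.ReflTransGen.refl, kconn_of_sep h3.1 (conn0 hG hs hda hdb), ?_⟩
      obtain ⟨x, y, hxy, hX, hx, hy⟩ := h.edge₂
      intro hc
      exact h.disj x (h.inv (hc p (h.supp hp) x (h.swap.supp hx)) hp) hx

end EssTri

/-- **Lemma (not_X_essential).** If `G[X]` has precisely two components and `e ∉ X` is
essential, then one of three configurations occurs. -/
theorem essential_edge_trichotomy (C : CGraph) (hWF : C.WF) (h3 : KConnected 3 C.G)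
    (hcomp : edgeComponents C.X = 2) (e : Sym2 C.V) (he : e ∈ C.G.edgeSet) (hex : e ∉ C.X)
    (hess : Essential C e) :
    JoinsComponents C.X e ∨
    (∃ f, SingleEdgeComponent C.X f ∧
      ∃ v ∈ e, v ∈ f ∧ vdeg C.G v = 3 ∧
        ∃ w, C.G.Adj v w ∧ s(v, w) ≠ e ∧ s(v, w) ≠ f ∧ JoinsComponents C.X s(v, w)) ∨
    (∃ v₁ v₂ z : C.V, e = s(v₁, v₂) ∧ s(v₁, z) ∈ C.X ∧ s(v₂, z) ∈ C.X ∧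
      s(v₁, z) ≠ s(v₂, z) ∧
      (∀ g ∈ C.X, (∃ b ∈ g, (fromEdgeSet C.X).Reachable b z) →
        g = s(v₁, z) ∨ g = s(v₂, z)) ∧
      vdeg C.G v₁ = 3 ∧ vdeg C.G v₂ = 3 ∧
      (∀ i ∈ ({v₁, v₂} : Set C.V),
        ∃ w, C.G.Adj i w ∧ s(i, w) ≠ e ∧ JoinsComponents C.X s(i, w))) := by
  obtain ⟨K₁, K₂, hK⟩ := EssTri.exists_comps hcomp
  induction e with
  | _ a b =>
    have hab : C.G.Adj a b := he
    by_cases hj : JoinsComponents C.X s(a, b)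
    · exact Or.inl hj
    right
    have h1 : ¬ (a ∈ K₁ ∧ b ∈ K₂) := fun h => hj (hK.joins h.1 h.2)
    have h2 : ¬ (a ∈ K₂ ∧ b ∈ K₁) := fun h => hj (hK.swap.joins h.1 h.2)
    by_cases h : a ∈ K₂ ∨ b ∈ K₂
    · have ha := hK.disj a
      have hb := hK.disj b
      exact EssTri.main_aux C hWF h3 hK.swap hab hex (by tauto) (by tauto) hess
    · exact EssTri.main_aux C hWF h3 hK hab hex (by tauto) (by tauto) hess
end

section
/- Let G be a 3-connected simple graph and X a disconnected edge set of G such that every edge not in X is essential. Assume some connected component C of G[X] consists of a single edge, and there is an edge vw of G such that v is a vertex of C and w is not a vertex of G[X]. Then (G,X) is the constraint wheel. -/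
open SimpleGraph

section Aux
variable {V : Type}

/-- A separation of `G` with separator `S` and sides `P`, `Q`. -/
structure Sepn (G : SimpleGraph V) (S P Q : Set V) : Prop where
  neP : P.Nonempty
  neQ : Q.Nonempty
  cov : ∀ x, x ∈ S ∨ x ∈ P ∨ x ∈ Q
  sp : ∀ x ∈ S, x ∉ P
  sq : ∀ x ∈ S, x ∉ Q
  pq : ∀ x ∈ P, x ∉ Q
  na : ∀ p ∈ P, ∀ q ∈ Q, ¬ G.Adj p q

theorem Sepn.symm {G : SimpleGraph V} {S P Q : Set V} (h : Sepn G S P Q) : Sepn G S Q P where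
  neP := h.neQ
  neQ := h.neP
  cov x := by rcases h.cov x with h | h | h <;> tauto
  sp := h.sq
  sq := h.sp
  pq x hx hx' := h.pq x hx' hx
  na p hp q hq hpq := h.na q hq p hp hpq.symm

theorem Sepn.not_connected {G : SimpleGraph V} {S P Q : Set V} (h : Sepn G S P Q) :
    ¬ (G.induce Sᶜ).Connected := by
  intro hc
  obtain ⟨p, hp⟩ := h.neP
  obtain ⟨q, hq⟩ := h.neQ
  have hpS : p ∈ Sᶜ := fun hs => h.sp p hs hp
  have hqS : q ∈ Sᶜ := fun hs => h.sq q hs hq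
  obtain ⟨W⟩ := hc.preconnected ⟨p, hpS⟩ ⟨q, hqS⟩
  have key : ∀ (a b : (Sᶜ : Set V)), (G.induce Sᶜ).Walk a b → a.1 ∈ P → b.1 ∈ P := by
    intro a b W
    induction W with
    | nil => exact id
    | @cons a c b hac _ ih =>
      intro ha
      apply ih
      rcases h.cov c.1 with h' | h' | h'
      · exact absurd h' c.2
      · exact h'
      · exact absurd hac (h.na _ ha _ h')
  exact h.pq q (key _ _ W hp) hq

theorem exists_sepn {G : SimpleGraph V} {S : Set V} (hne : (Sᶜ : Set V).Nonempty)
    (h : ¬ (G.induce Sᶜ).Connected) : ∃ P Q, Sepn G S P Q := by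
  have : ¬ (G.induce Sᶜ).Preconnected := by
    intro hp
    have : Nonempty (Sᶜ : Set V) := hne.to_subtype
    exact h ⟨hp⟩
  unfold SimpleGraph.Preconnected at this
  push Not at this
  obtain ⟨a, b, hab⟩ := this
  refine ⟨{x | ∃ hx : x ∈ Sᶜ, (G.induce Sᶜ).Reachable a ⟨x, hx⟩},
    {x | ∃ hx : x ∈ Sᶜ, ¬ (G.induce Sᶜ).Reachable a ⟨x, hx⟩}, ?_⟩
  refine ⟨⟨a.1, a.2, Reachable.refl _⟩, ⟨b.1, b.2, hab⟩, ?_, ?_, ?_, ?_, ?_⟩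
  · intro x
    by_cases hx : x ∈ S
    · exact Or.inl hx
    · right
      by_cases hr : (G.induce Sᶜ).Reachable a ⟨x, hx⟩
      · exact Or.inl ⟨hx, hr⟩
      · exact Or.inr ⟨hx, hr⟩
  · rintro x hx ⟨hx', _⟩
    exact hx' hx
  · rintro x hx ⟨hx', _⟩
    exact hx' hx
  · rintro x ⟨_, h1⟩ ⟨_, h2⟩
    exact h2 h1
  · rintro p ⟨hp, h1⟩ q ⟨hq, h2⟩ hpq
    apply h2
    refine h1.trans (Adj.reachable ?_)
    exact hpq

/-- No separation of order less than three. -/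
def NoSep (G : SimpleGraph V) : Prop := ∀ S P Q : Set V, S.ncard < 3 → ¬ Sepn G S P Q

theorem kconn_iff [Finite V] (G : SimpleGraph V) :
    KConnected 3 G ↔ 3 < Nat.card V ∧ NoSep G := by
  constructor
  · rintro ⟨h1, h2⟩
    exact ⟨h1, fun S P Q hS hsep => hsep.not_connected (h2 S hS)⟩
  · rintro ⟨h1, h2⟩
    refine ⟨h1, fun S hS => ?_⟩
    by_contra hc
    have hne : (Sᶜ : Set V).Nonempty := by
      by_contra hne
      rw [Set.not_nonempty_iff_eq_empty, Set.compl_empty_iff] at hne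
      rw [hne, Set.ncard_univ] at hS
      omega
    obtain ⟨P, Q, hsep⟩ := exists_sepn hne hc
    exact h2 S P Q hS hsep

theorem ncard_pair_lt (p q : V) : ({p, q} : Set V).ncard < 3 := by
  have := Set.ncard_insert_le p {q}
  rw [Set.ncard_singleton] at this
  omega

theorem exists_not_mem_of_ncard_lt [Finite V] (S : Set V) (h : S.ncard < Nat.card V) :
    ∃ t, t ∉ S := by
  by_contra hc
  push Not at hc
  have : S = Set.univ := Set.eq_univ_of_forall hc
  rw [this, Set.ncard_univ] at h
  omega

theorem deg_three [Finite V] {G : SimpleGraph V} (h3 : KConnected 3 G) (z p q : V) :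
    ∃ t, G.Adj z t ∧ t ≠ p ∧ t ≠ q := by
  rw [kconn_iff] at h3
  by_contra hc
  push Not at hc
  have h1 := ncard_pair_lt p q
  obtain ⟨t, ht⟩ := exists_not_mem_of_ncard_lt (insert z ({p, q} : Set V))
    (by have := Set.ncard_insert_le z ({p, q} : Set V); omega)
  refine h3.2 ({p, q} \ {z}) {z} (({p, q} ∪ {z})ᶜ) ?_ ⟨⟨z, rfl⟩, ⟨t, ?_⟩, ?_, ?_, ?_, ?_, ?_⟩
  · exact lt_of_le_of_lt (Set.ncard_le_ncard Set.sdiff_subset (Set.toFinite _)) h1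
  · simp at ht ⊢; tauto
  · intro x; simp; tauto
  · intro x; simp
  · intro x; simp; tauto
  · intro x; simp; tauto
  · intro a ha b hb hab
    simp at ha hb
    subst ha
    have := hc b hab
    tauto

/-- Every vertex of a minimal separator has a neighbour on every side. -/
theorem sep_nbr [Finite V] {G : SimpleGraph V} (h3 : NoSep G) {v w x : V} {A B : Set V}
    (h : Sepn G {v, w, x} A B) (hvw : v ≠ w) (hvx : v ≠ x) : ∃ a ∈ A, G.Adj v a := by
  by_contra hc
  push Not at hc
  refine h3 {w, x} A (insert v B) (ncard_pair_lt _ _) ⟨h.neP, ⟨v, by simp⟩, ?_, ?_, ?_, ?_, ?_⟩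
  · intro y
    have := h.cov y
    simp at this ⊢; tauto
  · intro y hy
    exact h.sp y (by simp at hy ⊢; tauto)
  · intro y hy
    have := h.sq y (by simp at hy ⊢; tauto)
    simp at hy ⊢
    refine ⟨?_, this⟩
    rintro rfl
    tauto
  · intro y hy
    have h1 := h.pq y hy
    have h2 := h.sp y
    simp at h2 ⊢
    tauto
  · intro p hp q hq
    rcases hq with rfl | hq
    · exact fun h' => hc p hp h'.symm
    · exact h.na p hp q hq

theorem two_le_of_meet [Finite V] {G : SimpleGraph V} (h3 : NoSep G) {v w x : V} {A B S P Q : Set V}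
    (h : Sepn G {v, w, x} A B) (hs : Sepn (G.deleteEdges {s(v, w)}) S P Q)
    (hv : v ∈ P) (hw : w ∈ Q) (hx : x ∉ P) (hne : (P ∩ A).Nonempty) :
    2 ≤ (S ∩ insert x A).ncard := by
  by_contra hc
  have hA : ∀ t ∈ A, t ≠ v ∧ t ≠ w ∧ t ≠ x := by
    intro t ht
    refine ⟨?_, ?_, ?_⟩ <;> rintro rfl <;> exact h.sp _ (by simp) ht
  have hvw : v ≠ w := by rintro rfl; exact hs.pq _ hv hw
  refine h3 (insert v (S ∩ insert x A)) (P ∩ A) ((insert v (S ∩ insert x A) ∪ (P ∩ A))ᶜ) ?_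
    ⟨hne, ⟨w, ?_⟩, ?_, ?_, ?_, ?_, ?_⟩
  · have := Set.ncard_insert_le v (S ∩ insert x A); omega
  · have h1 := hs.sq w
    have h2 : w ∉ P := fun h' => hs.pq w h' hw
    simp; tauto
  · intro y; simp only [Set.mem_compl_iff, Set.mem_union]; tauto
  · rintro y (rfl | ⟨h1, h2⟩) ⟨h3, h4⟩
    · exact (hA _ h4).1 rfl
    · exact hs.sp _ h1 h3
  · intro y hy h'; exact h' (Or.inl hy)
  · intro y hy h'; exact h' (Or.inr hy)
  · rintro t ⟨htP, htA⟩ u hu hadj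
    simp only [Set.mem_compl_iff, Set.mem_union, Set.mem_insert_iff, Set.mem_inter_iff] at hu
    push Not at hu
    have hH : (G.deleteEdges {s(v, w)}).Adj t u := by
      rw [deleteEdges_adj]
      refine ⟨hadj, ?_⟩
      simp only [Set.mem_singleton_iff, Sym2.eq_iff]
      have := hA t htA
      tauto
    have hQ : u ∉ Q := fun hq => hs.na t htP u hq hH
    have hB : u ∉ B := fun hq => h.na t htA u hq hadj
    have c1 := h.cov u
    have c2 := hs.cov u
    simp at c1
    have : u ≠ w := by rintro rfl; exact hQ hw
    have : u = x → u ∉ P := by rintro rfl; exact hx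
    tauto

theorem K_half [Finite V] {G : SimpleGraph V} (h3 : NoSep G) {v w x : V} {A B S P Q : Set V}
    (h : Sepn G {v, w, x} A B) (hvx : v ≠ x) (hS : S.ncard < 3)
    (hs : Sepn (G.deleteEdges {s(v, w)}) S P Q)
    (hv : v ∈ P) (hw : w ∈ Q) (hx : x ∉ P) : P = {v} := by
  have hvw : v ≠ w := by rintro rfl; exact hs.pq _ hv hw
  have key : ∀ A B, Sepn G {v, w, x} A B → ¬ (P ∩ A).Nonempty := by
    intro A B h hne
    have h1 := two_le_of_meet h3 h hs hv hw hx hne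
    have e1 : S ∩ insert x A = S :=
      Set.eq_of_subset_of_ncard_le Set.inter_subset_left (by omega) (Set.toFinite _)
    obtain ⟨b, hb, hvb⟩ := sep_nbr h3 h.symm hvw hvx
    have hbw : b ≠ w := by rintro rfl; exact h.sq _ (by simp) hb
    have hbx : b ≠ x := by rintro rfl; exact h.sq _ (by simp) hb
    have hbS : b ∉ S := by
      intro hbS
      rw [← e1] at hbS
      rcases hbS.2 with h' | h'
      · exact hbx h'
      · exact h.pq _ h' hb
    have hbQ : b ∉ Q := by
      intro hq
      refine hs.na v hv b hq ?_
      rw [deleteEdges_adj]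
      refine ⟨hvb, ?_⟩
      simp only [Set.mem_singleton_iff, Sym2.eq_iff]
      tauto
    have hbP : b ∈ P := by have := hs.cov b; tauto
    have h2 := two_le_of_meet h3 h.symm hs hv hw hx ⟨b, hbP, hb⟩
    have e2 : S ∩ insert x B = S :=
      Set.eq_of_subset_of_ncard_le Set.inter_subset_left (by omega) (Set.toFinite _)
    have : S ⊆ {x} := by
      intro y hy
      have y1 : y ∈ S ∩ insert x A := by rw [e1]; exact hy
      have y2 : y ∈ S ∩ insert x B := by rw [e2]; exact hy
      rcases y1.2 with h' | h'
      · exact h'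
      · rcases y2.2 with h'' | h''
        · exact h''
        · exact absurd h'' (h.pq _ h')
    have := Set.ncard_le_ncard this (Set.toFinite _)
    rw [Set.ncard_singleton, ← e1] at this
    omega
  ext t
  constructor
  · intro ht
    rcases h.cov t with h' | h' | h'
    · simp at h'
      rcases h' with rfl | rfl | rfl
      · rfl
      · exact absurd hw (hs.pq _ ht)
      · exact absurd ht hx
    · exact absurd ⟨t, ht, h'⟩ (key A B h)
    · exact absurd ⟨t, ht, h'⟩ (key B A h.symm)
  · rintro rfl; exact hv

theorem K_main [Finite V] {G : SimpleGraph V} (h3 : NoSep G) {v w x : V} {A B S P Q : Set V}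
    (h : Sepn G {v, w, x} A B) (hvx : v ≠ x) (hwx : w ≠ x) (hS : S.ncard < 3)
    (hs : Sepn (G.deleteEdges {s(v, w)}) S P Q) :
    ∃ d, (d = v ∨ d = w) ∧ (P = {d} ∨ Q = {d}) := by
  have core : ∀ P Q, Sepn (G.deleteEdges {s(v, w)}) S P Q → v ∈ P → w ∈ Q →
      P = {v} ∨ Q = {w} := by
    intro P Q hs hv hw
    by_cases hx : x ∈ P
    · right
      have h' : Sepn G {w, v, x} A B := by rw [Set.insert_comm]; exact h
      have hs' : Sepn (G.deleteEdges {s(w, v)}) S Q P := by rw [Sym2.eq_swap]; exact hs.symm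
      exact K_half h3 h' hwx hS hs' hw hv (hs.pq _ hx)
    · left
      exact K_half h3 h hvx hS hs hv hw hx
  by_cases c1 : v ∈ P ∧ w ∈ Q
  · rcases core P Q hs c1.1 c1.2 with h' | h'
    · exact ⟨v, by simp, Or.inl h'⟩
    · exact ⟨w, by simp, Or.inr h'⟩
  by_cases c2 : v ∈ Q ∧ w ∈ P
  · rcases core Q P hs.symm c2.1 c2.2 with h' | h'
    · exact ⟨v, by simp, Or.inr h'⟩
    · exact ⟨w, by simp, Or.inl h'⟩
  exfalso
  refine h3 S P Q hS ⟨hs.neP, hs.neQ, hs.cov, hs.sp, hs.sq, hs.pq, ?_⟩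
  intro p hp q hq hpq
  apply hs.na p hp q hq
  rw [deleteEdges_adj]
  refine ⟨hpq, ?_⟩
  simp only [Set.mem_singleton_iff, Sym2.eq_iff]
  rintro (⟨rfl, rfl⟩ | ⟨rfl, rfl⟩)
  · exact c1 ⟨hp, hq⟩
  · exact c2 ⟨hq, hp⟩

/-- All small separations cut off a single vertex of `D`. -/
def Good (G : SimpleGraph V) (D : Set V) : Prop :=
  ∀ S P Q : Set V, S.ncard < 3 → Sepn G S P Q → ∃ d ∈ D, P = {d} ∨ Q = {d}

/-- The vertices of degree at most two. -/
def lowDeg (G : SimpleGraph V) : Set V := {z | ∃ p q, ∀ t, G.Adj z t → t = p ∨ t = q}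

theorem subset_pair_of_ncard_lt [Finite V] (v : V) (S : Set V) (h : S.ncard < 3) :
    ∃ p q : V, S ⊆ {p, q} := by
  have : S.ncard = 0 ∨ S.ncard = 1 ∨ S.ncard = 2 := by omega
  rcases this with h | h | h
  · rw [Set.ncard_eq_zero] at h
    exact ⟨v, v, by simp [h]⟩
  · obtain ⟨a, rfl⟩ := Set.ncard_eq_one.1 h
    exact ⟨a, a, by simp⟩
  · obtain ⟨a, b, _, rfl⟩ := Set.ncard_eq_two.1 h
    exact ⟨a, b, le_rfl⟩

theorem good_delete [Finite V] {G : SimpleGraph V} (h3 : NoSep G) {v w x : V} {A B : Set V}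
    (h : Sepn G {v, w, x} A B) (hvx : v ≠ x) (hwx : w ≠ x) :
    Good (G.deleteEdges {s(v, w)}) ({v, w} ∩ lowDeg (G.deleteEdges {s(v, w)})) := by
  intro S P Q hS hs
  obtain ⟨d, hd, hPQ⟩ := K_main h3 h hvx hwx hS hs
  refine ⟨d, ⟨by simpa using hd, ?_⟩, hPQ⟩
  have core : ∀ P Q, Sepn (G.deleteEdges {s(v, w)}) S P Q → P = {d} →
      d ∈ lowDeg (G.deleteEdges {s(v, w)}) := by
    intro P Q hs hP
    obtain ⟨p, q, hpq⟩ := subset_pair_of_ncard_lt v S hS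
    refine ⟨p, q, fun t ht => ?_⟩
    rcases hs.cov t with h' | h' | h'
    · simpa using hpq h'
    · rw [hP] at h'
      rw [Set.mem_singleton_iff.1 h'] at ht
      exact absurd ht (SimpleGraph.irrefl _)
    · exact absurd ht (hs.na d (by rw [hP]; rfl) t h')
  rcases hPQ with hPd | hQd
  · exact core P Q hs hPd
  · exact core Q P hs.symm hQd

theorem contractFun_self {u v : V} (h : u ≠ v) : contractFun h v = ⟨u, h⟩ := by
  simp [contractFun]

theorem contractFun_of_ne {u v : V} (h : u ≠ v) {x : V} (hx : x ≠ v) :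
    contractFun h x = ⟨x, hx⟩ := by
  simp [contractFun, hx]

theorem contract_adj {G : SimpleGraph V} {u v : V} (h : u ≠ v) (x y : {w : V // w ≠ v}) :
    (contractGraph G h).Adj x y ↔
      x ≠ y ∧ ∃ a b, G.Adj a b ∧ contractFun h a = x ∧ contractFun h b = y := by
  unfold contractGraph
  rw [fromEdgeSet_adj]
  constructor
  · rintro ⟨⟨e, he, hxy⟩, hne⟩
    refine ⟨hne, ?_⟩
    induction e with
    | _ a b =>
      rw [Sym2.map_mk, Sym2.eq_iff] at hxy
      rw [mem_edgeSet] at he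
      rcases hxy with ⟨h1, h2⟩ | ⟨h1, h2⟩
      · exact ⟨a, b, he, h1, h2⟩
      · exact ⟨b, a, he.symm, h2, h1⟩
  · rintro ⟨hne, a, b, hab, rfl, rfl⟩
    exact ⟨⟨s(a, b), hab, by simp⟩, hne⟩

theorem contract_adj_old {G : SimpleGraph V} {u v : V} (h : u ≠ v) {a b : V} (hab : G.Adj a b)
    (ha : a ≠ v) (hb : b ≠ v) : (contractGraph G h).Adj ⟨a, ha⟩ ⟨b, hb⟩ := by
  rw [contract_adj]
  refine ⟨?_, a, b, hab, contractFun_of_ne h ha, contractFun_of_ne h hb⟩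
  intro h'
  exact hab.ne (Subtype.ext_iff.1 h')

theorem contract_adj_new {G : SimpleGraph V} {u v : V} (h : u ≠ v) {b : V} (hab : G.Adj v b)
    (hb : b ≠ v) (hbu : b ≠ u) : (contractGraph G h).Adj ⟨u, h⟩ ⟨b, hb⟩ := by
  rw [contract_adj]
  refine ⟨?_, v, b, hab, contractFun_self h, contractFun_of_ne h hb⟩
  intro h'
  exact hbu (Subtype.ext_iff.1 h').symm

theorem contract_adj_rev {G : SimpleGraph V} {u v : V} (h : u ≠ v) {z : V} (hz : z ≠ v)
    (hzu : z ≠ u) (hzv : ¬ G.Adj z v) {t : {w : V // w ≠ v}}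
    (hadj : (contractGraph G h).Adj ⟨z, hz⟩ t) : G.Adj z t.1 := by
  rw [contract_adj] at hadj
  obtain ⟨_, a, b, hab, ha, hb⟩ := hadj
  have haz : a = z := by
    by_cases hav : a = v
    · subst hav
      rw [contractFun_self] at ha
      exact absurd (Subtype.ext_iff.1 ha).symm hzu
    · rw [contractFun_of_ne h hav] at ha
      exact Subtype.ext_iff.1 ha
  subst haz
  have hbv : b ≠ v := by rintro rfl; exact hzv hab
  rw [contractFun_of_ne h hbv] at hb
  rw [← hb]
  exact hab

theorem card_ne [Finite V] (v : V) : Nat.card {w : V // w ≠ v} + 1 = Nat.card V := by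
  have h1 : Nat.card {w : V // w ≠ v} = ({v}ᶜ : Set V).ncard := by
    rw [← Nat.card_coe_set_eq]; rfl
  have h2 := Set.ncard_add_ncard_compl ({v} : Set V)
  rw [Set.ncard_singleton] at h2
  omega

/-- Lifting separations through the suppression of a vertex of degree two. -/
theorem good_suppress [Finite V] {G : SimpleGraph V} {D : Set V} (hG : Good G D) {u d c : V}
    (hud : G.Adj u d) (hd : ∀ t, G.Adj d t → t = u ∨ t = c) :
    Good (contractGraph G hud.ne) {x | x.1 ∈ D} := by
  have h := hud.ne
  have key : ∀ S' P' Q' : Set {w : V // w ≠ d}, Sepn (contractGraph G h) S' P' Q' →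
      (⟨u, h⟩ ∈ P' ∨ (⟨u, h⟩ ∈ S' ∧ ∀ hc : c ≠ d, ⟨c, hc⟩ ∉ Q')) →
      Sepn G (Subtype.val '' S') (insert d (Subtype.val '' P')) (Subtype.val '' Q') := by
    intro S' P' Q' hs hu
    refine ⟨⟨d, by simp⟩, hs.neQ.image _, ?_, ?_, ?_, ?_, ?_⟩
    · intro x
      by_cases hx : x = d
      · simp [hx]
      · rcases hs.cov ⟨x, hx⟩ with h' | h' | h'
        · exact Or.inl ⟨_, h', rfl⟩
        · exact Or.inr (Or.inl (Or.inr ⟨_, h', rfl⟩))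
        · exact Or.inr (Or.inr ⟨_, h', rfl⟩)
    · rintro _ ⟨x, hx, rfl⟩ (h' | ⟨y, hy, hxy⟩)
      · exact x.2 h'
      · rw [Subtype.ext hxy] at hy
        exact hs.sp _ hx hy
    · rintro _ ⟨x, hx, rfl⟩ ⟨y, hy, hxy⟩
      rw [Subtype.ext hxy] at hy
      exact hs.sq _ hx hy
    · rintro z (rfl | ⟨x, hx, rfl⟩) ⟨y, hy, hxy⟩
      · exact y.2 hxy
      · rw [Subtype.ext hxy] at hy
        exact hs.pq _ hx hy
    · rintro z (rfl | ⟨x, hx, rfl⟩) _ ⟨y, hy, rfl⟩ hadj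
      · by_cases hyu : y.1 = u
        · have : y = ⟨u, h⟩ := Subtype.ext hyu
          rw [this] at hy
          rcases hu with hu | hu
          · exact hs.pq _ hu hy
          · exact hs.sq _ hu.1 hy
        · have hyc : y.1 = c := (hd _ hadj).resolve_left hyu
          rcases hu with hu | hu
          · exact hs.na _ hu _ hy (contract_adj_new h hadj y.2 hyu)
          · refine hu.2 (hyc ▸ y.2) ?_
            convert hy
            exact hyc.symm
      · exact hs.na _ hx _ hy (contract_adj_old h hadj x.2 y.2)
  have key2 : ∀ S' P' Q' : Set {w : V // w ≠ d}, S'.ncard < 3 →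
      Sepn (contractGraph G h) S' P' Q' →
      (⟨u, h⟩ ∈ P' ∨ (⟨u, h⟩ ∈ S' ∧ ∀ hc : c ≠ d, ⟨c, hc⟩ ∉ Q')) →
      ∃ e ∈ ({x | x.1 ∈ D} : Set {w : V // w ≠ d}), P' = {e} ∨ Q' = {e} := by
    intro S' P' Q' hS hs hu
    have hsep := key S' P' Q' hs hu
    have hS2 : (Subtype.val '' S').ncard < 3 := lt_of_le_of_lt (Set.ncard_image_le (Set.toFinite _)) hS
    obtain ⟨e, heD, he⟩ := hG _ _ _ hS2 hsep
    rcases he with he | he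
    · exfalso
      obtain ⟨p, hp⟩ := hs.neP
      have h1 : d ∈ ({e} : Set V) := by rw [← he]; simp
      have h2 : p.1 ∈ ({e} : Set V) := by rw [← he]; exact Or.inr ⟨p, hp, rfl⟩
      rw [Set.mem_singleton_iff] at h1 h2
      exact p.2 (h2.trans h1.symm)
    · obtain ⟨q, hq⟩ := hs.neQ
      have h2 : ∀ q ∈ Q', q.1 = e := by
        intro q hq
        have : q.1 ∈ ({e} : Set V) := by rw [← he]; exact ⟨q, hq, rfl⟩
        exact this
      refine ⟨q, ?_, Or.inr ?_⟩
      · show q.1 ∈ D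
        rw [h2 q hq]; exact heD
      · ext y
        constructor
        · intro hy
          exact Subtype.ext ((h2 y hy).trans (h2 q hq).symm)
        · rintro rfl; exact hq
  intro S' P' Q' hS hs
  have swap : ∀ P Q : Set {w : V // w ≠ d},
      (∃ e ∈ ({x | x.1 ∈ D} : Set {w : V // w ≠ d}), Q = {e} ∨ P = {e}) →
      (∃ e ∈ ({x | x.1 ∈ D} : Set {w : V // w ≠ d}), P = {e} ∨ Q = {e}) := by
    rintro P Q ⟨e, he, h⟩
    exact ⟨e, he, h.symm⟩
  rcases hs.cov ⟨u, h⟩ with h' | h' | h'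
  · by_cases hc : ∃ hc : c ≠ d, ⟨c, hc⟩ ∈ Q'
    · obtain ⟨hc, hcQ⟩ := hc
      refine swap _ _ (key2 S' Q' P' hS hs.symm (Or.inr ⟨h', fun _ hcP => hs.pq _ hcP hcQ⟩))
    · push Not at hc
      exact key2 S' P' Q' hS hs (Or.inr ⟨h', hc⟩)
  · exact key2 S' P' Q' hS hs (Or.inl h')
  · have hfinal := key2 S' Q' P' hS hs.symm (Or.inl h')
    exact swap _ _ hfinal

/-- If contracting `vw` destroys 3-connectivity, then `v, w` lie in a 3-separator. -/
theorem exists_three_sep [Finite V] {G : SimpleGraph V} (h3 : NoSep G) (h5 : 4 < Nat.card V)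
    {v w : V} (hvw : v ≠ w) (hadj : G.Adj v w) (hn : ¬ KConnected 3 (contractGraph G hvw)) :
    ∃ x A B, v ≠ x ∧ w ≠ x ∧ Sepn G {v, w, x} A B := by
  rw [kconn_iff] at hn
  have hcard := card_ne w
  have : ¬ NoSep (contractGraph G hvw) := fun h => hn ⟨by omega, h⟩
  unfold NoSep at this
  push Not at this
  obtain ⟨S', P', Q', hS, hs⟩ := this
  have hvS : ⟨v, hvw⟩ ∈ S' := by
    by_contra hvS
    have core : ∀ P' Q' : Set {x : V // x ≠ w}, Sepn (contractGraph G hvw) S' P' Q' →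
        ⟨v, hvw⟩ ∈ P' → False := by
      intro P' Q' hs hvP
      refine h3 (Subtype.val '' S') (insert w (Subtype.val '' P')) (Subtype.val '' Q')
        (lt_of_le_of_lt (Set.ncard_image_le (Set.toFinite _)) hS)
        ⟨⟨w, by simp⟩, hs.neQ.image _, ?_, ?_, ?_, ?_, ?_⟩
      · intro x
        by_cases hx : x = w
        · simp [hx]
        · rcases hs.cov ⟨x, hx⟩ with h' | h' | h'
          · exact Or.inl ⟨_, h', rfl⟩
          · exact Or.inr (Or.inl (Or.inr ⟨_, h', rfl⟩))
          · exact Or.inr (Or.inr ⟨_, h', rfl⟩)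
      · rintro _ ⟨x, hx, rfl⟩ (h' | ⟨y, hy, hxy⟩)
        · exact x.2 h'
        · rw [Subtype.ext hxy] at hy
          exact hs.sp _ hx hy
      · rintro _ ⟨x, hx, rfl⟩ ⟨y, hy, hxy⟩
        rw [Subtype.ext hxy] at hy
        exact hs.sq _ hx hy
      · rintro z (rfl | ⟨x, hx, rfl⟩) ⟨y, hy, hxy⟩
        · exact y.2 hxy
        · rw [Subtype.ext hxy] at hy
          exact hs.pq _ hx hy
      · rintro z (rfl | ⟨x, hx, rfl⟩) _ ⟨y, hy, rfl⟩ hadj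
        · by_cases hyu : y.1 = v
          · have : y = ⟨v, hvw⟩ := Subtype.ext hyu
            rw [this] at hy
            exact hs.pq _ hvP hy
          · exact hs.na _ hvP _ hy (contract_adj_new hvw hadj y.2 hyu)
        · exact hs.na _ hx _ hy (contract_adj_old hvw hadj x.2 y.2)
    rcases hs.cov ⟨v, hvw⟩ with h' | h' | h'
    · exact hvS h'
    · exact core _ _ hs h'
    · exact core _ _ hs.symm h'
  have hsep : Sepn G (insert w (Subtype.val '' S')) (Subtype.val '' P') (Subtype.val '' Q') := by
    refine ⟨hs.neP.image _, hs.neQ.image _, ?_, ?_, ?_, ?_, ?_⟩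
    · intro x
      by_cases hx : x = w
      · simp [hx]
      · rcases hs.cov ⟨x, hx⟩ with h' | h' | h'
        · exact Or.inl (Or.inr ⟨_, h', rfl⟩)
        · exact Or.inr (Or.inl ⟨_, h', rfl⟩)
        · exact Or.inr (Or.inr ⟨_, h', rfl⟩)
    · rintro z (rfl | ⟨x, hx, rfl⟩) ⟨y, hy, hxy⟩
      · exact y.2 hxy
      · rw [Subtype.ext hxy] at hy
        exact hs.sp _ hx hy
    · rintro z (rfl | ⟨x, hx, rfl⟩) ⟨y, hy, hxy⟩
      · exact y.2 hxy
      · rw [Subtype.ext hxy] at hy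
        exact hs.sq _ hx hy
    · rintro _ ⟨x, hx, rfl⟩ ⟨y, hy, hxy⟩
      rw [Subtype.ext hxy] at hy
      exact hs.pq _ hx hy
    · rintro _ ⟨x, hx, rfl⟩ _ ⟨y, hy, rfl⟩ hadj
      exact hs.na _ hx _ hy (contract_adj_old hvw hadj x.2 y.2)
  obtain ⟨p, q, hpq⟩ := subset_pair_of_ncard_lt (⟨v, hvw⟩ : {x : V // x ≠ w}) S' hS
  have : ∃ x, v ≠ x ∧ w ≠ x ∧ insert w (Subtype.val '' S') = {v, w, x} := by
    by_cases hx : ∃ y ∈ S', y ≠ ⟨v, hvw⟩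
    · obtain ⟨y, hy, hyv⟩ := hx
      refine ⟨y.1, fun h => hyv (Subtype.ext h.symm), fun h => y.2 h.symm, ?_⟩
      have hSe : S' = {⟨v, hvw⟩, y} := by
        apply Set.Subset.antisymm
        · intro t ht
          have h1 := hpq ht
          have h2 := hpq hy
          have h3 := hpq hvS
          simp only [Set.mem_insert_iff, Set.mem_singleton_iff] at h1 h2 h3 ⊢
          grind
        · intro t ht
          rcases ht with rfl | rfl
          · exact hvS
          · exact hy
      rw [hSe, Set.image_pair, Set.insert_comm]
    · exfalso
      push Not at hx
      have hSe : S' = {⟨v, hvw⟩} := by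
        ext t
        exact ⟨fun ht => hx t ht, by rintro rfl; exact hvS⟩
      refine h3 _ _ _ ?_ hsep
      rw [hSe, Set.image_singleton]
      exact ncard_pair_lt _ _
  obtain ⟨x, hvx, hwx, he⟩ := this
  exact ⟨x, _, _, hvx, hwx, he ▸ hsep⟩

end Aux

/-- `T` is a union of components of `X` (as far as edges of `X` are concerned). -/
def NoCross {V : Type} (X : Set (Sym2 V)) (T : Set V) : Prop :=
  ∀ a b, s(a, b) ∈ X → (a ∈ T ↔ b ∈ T)

/-- `T` witnesses that `X` is disconnected, even after removing the edge `g`. -/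
structure Disc {V : Type} (X : Set (Sym2 V)) (g : Set (Sym2 V)) (T : Set V) : Prop where
  nc : NoCross X T
  ein : ∃ a b, a ≠ b ∧ s(a, b) ∈ X ∧ s(a, b) ∉ g ∧ a ∈ T
  eout : ∃ a b, a ≠ b ∧ s(a, b) ∈ X ∧ s(a, b) ∉ g ∧ a ∉ T

theorem Disc.not_connected {V : Type} {X g : Set (Sym2 V)} {T : Set V} (h : Disc X g T) :
    ¬ EdgeSetConnected X := by
  intro hc
  obtain ⟨a, b, hab, habX, -, haT⟩ := h.ein
  obtain ⟨c, d, hcd, hcdX, -, hcT⟩ := h.eout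
  obtain ⟨W⟩ := hc a ⟨b, (fromEdgeSet_adj _).2 ⟨habX, hab⟩⟩ c
    ⟨d, (fromEdgeSet_adj _).2 ⟨hcdX, hcd⟩⟩
  have key : ∀ x y, (fromEdgeSet X).Walk x y → x ∈ T → y ∈ T := by
    intro x y W
    induction W with
    | nil => exact id
    | @cons x z y hxz _ ih =>
      intro hx
      rw [fromEdgeSet_adj] at hxz
      exact ih ((h.nc _ _ hxz.1).1 hx)
  exact hcT (key _ _ W haT)

/-- The contracted constraint. -/
def contractX {V : Type} (X : Set (Sym2 V)) {u v : V} (huv : u ≠ v) :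
    Set (Sym2 {w : V // w ≠ v}) :=
  {e | e ∈ Sym2.map (contractFun huv) '' X ∧ ¬ e.IsDiag}

theorem disc_contract {V : Type} (X : Set (Sym2 V)) {u v : V} (huv : u ≠ v) {T : Set V}
    (h : Disc X {s(u, v)} T) (hT : u ∈ T ↔ v ∈ T) :
    Disc (contractX X huv) ∅ {x | x.1 ∈ T} := by
  have hmem : ∀ a, (contractFun huv a).1 ∈ T ↔ a ∈ T := by
    intro a
    by_cases ha : a = v
    · subst ha; rw [contractFun_self]; exact hT
    · rw [contractFun_of_ne huv ha]
  have hne : ∀ a b, a ≠ b → s(a, b) ∉ ({s(u, v)} : Set (Sym2 V)) →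
      contractFun huv a ≠ contractFun huv b := by
    intro a b hab hs h'
    simp only [Set.mem_singleton_iff, Sym2.eq_iff] at hs
    by_cases ha : a = v
    · by_cases hb : b = v
      · exact hab (ha.trans hb.symm)
      · subst ha
        rw [contractFun_self, contractFun_of_ne huv hb] at h'
        have := Subtype.ext_iff.1 h'
        simp only at this
        exact hs (Or.inr ⟨rfl, this.symm⟩)
    · by_cases hb : b = v
      · subst hb
        rw [contractFun_self, contractFun_of_ne huv ha] at h'
        have := Subtype.ext_iff.1 h'
        simp only at this
        exact hs (Or.inl ⟨this, rfl⟩)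
      · rw [contractFun_of_ne huv ha, contractFun_of_ne huv hb] at h'
        exact hab (Subtype.ext_iff.1 h')
  refine ⟨?_, ?_, ?_⟩
  · rintro x y ⟨⟨e, he, hxy⟩, _⟩
    induction e with
    | _ a b =>
      have hab := h.nc a b he
      rw [Sym2.map_mk, Sym2.eq_iff] at hxy
      rcases hxy with ⟨rfl, rfl⟩ | ⟨rfl, rfl⟩
      · simp only [Set.mem_ofPred_eq, hmem]; exact hab
      · simp only [Set.mem_ofPred_eq, hmem]; exact hab.symm
  · obtain ⟨a, b, hab, habX, hg, haT⟩ := h.ein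
    refine ⟨contractFun huv a, contractFun huv b, hne a b hab hg,
      ⟨⟨s(a, b), habX, by simp⟩, ?_⟩, by simp, (hmem a).2 haT⟩
    rw [Sym2.mk_isDiag_iff]
    exact hne a b hab hg
  · obtain ⟨a, b, hab, habX, hg, haT⟩ := h.eout
    refine ⟨contractFun huv a, contractFun huv b, hne a b hab hg,
      ⟨⟨s(a, b), habX, by simp⟩, ?_⟩, by simp, fun h' => haT ((hmem a).1 h')⟩
    rw [Sym2.mk_isDiag_iff]
    exact hne a b hab hg

theorem noSep_of_good {V : Type} {G : SimpleGraph V} {D : Set V} (h : Good G D)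
    (hD : ∀ x, x ∉ D) : NoSep G := by
  intro S P Q hS hs
  obtain ⟨d, hd, _⟩ := h S P Q hS hs
  exact hD d hd

theorem BadMinor.of_contract {C : CGraph} {u v : C.V} (h : C.G.Adj u v)
    (hb : BadMinor (C.contract u v h.ne)) : BadMinor C := by
  obtain ⟨C', h1, h2, h3⟩ := hb
  exact ⟨C', Relation.ReflTransGen.head (CMinorStep.contr C u v h) h1, h2, h3⟩

/-- Suppressing at most one vertex of degree two. -/
theorem badMinor_one (C : CGraph) (D : Set C.V) (z : C.V) (hG : Good C.G D)
    (hD : ∀ x ∈ D, x = z) (hcard : 3 < Nat.card C.V) (T : Set C.V) (g : Set (Sym2 C.V))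
    (hT : Disc C.X g T)
    (hz : z ∈ D → 4 < Nat.card C.V ∧ ∃ r c, C.G.Adj r z ∧
      (∀ t, C.G.Adj z t → t = r ∨ t = c) ∧ (r ∈ T ↔ z ∈ T) ∧ g = {s(r, z)}) : BadMinor C := by
  by_cases hzD : z ∈ D
  · obtain ⟨h4, r, c, hrz, hN, hTrz, rfl⟩ := hz hzD
    apply BadMinor.of_contract hrz
    refine ⟨_, Relation.ReflTransGen.refl, ?_, (disc_contract C.X hrz.ne hT hTrz).not_connected⟩
    have hg := good_suppress hG hrz hN
    refine (kconn_iff (V := {x : C.V // x ≠ z}) _).2 ⟨?_, noSep_of_good hg ?_⟩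
    · have := card_ne z
      omega
    · intro x hx
      exact x.2 (hD _ hx)
  · refine ⟨C, Relation.ReflTransGen.refl, ?_, hT.not_connected⟩
    rw [kconn_iff]
    refine ⟨hcard, noSep_of_good hG ?_⟩
    intro x hx
    exact hzD (hD x hx ▸ hx)

theorem disc_contract_unsupp {V : Type} (X : Set (Sym2 V)) {a w : V} (haw : a ≠ w) {T : Set V}
    {g : Set (Sym2 V)} {g' : Set (Sym2 {x : V // x ≠ w})}
    (hw : ∀ b, s(b, w) ∉ X) (h : Disc X g T) (hT : a ∈ T ↔ w ∈ T)
    (hg : ∀ p q : {x : V // x ≠ w}, s(p, q) ∈ g' → s(p.1, q.1) ∈ g) :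
    Disc (contractX X haw) g' {x | x.1 ∈ T} := by
  have h0 : Disc X {s(a, w)} T := by
    have : ∀ p q, s(p, q) ∈ X → s(p, q) ∉ ({s(a, w)} : Set (Sym2 V)) := by
      intro p q hpq h'
      rw [Set.mem_singleton_iff] at h'
      rw [h'] at hpq
      exact hw _ hpq
    obtain ⟨h1, ⟨p, q, h2, h3, h4, h5⟩, ⟨p', q', h6, h7, h8, h9⟩⟩ := h
    exact ⟨h1, ⟨p, q, h2, h3, this _ _ h3, h5⟩, ⟨p', q', h6, h7, this _ _ h7, h9⟩⟩
  have h1 := disc_contract X haw h0 hT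
  have key : ∀ p q, p ≠ q → s(p, q) ∈ X → s(p, q) ∉ g → ∃ (hp : p ≠ w) (hq : q ≠ w),
      s((⟨p, hp⟩ : {x : V // x ≠ w}), ⟨q, hq⟩) ∈ (contractX X haw) ∧
      s((⟨p, hp⟩ : {x : V // x ≠ w}), ⟨q, hq⟩) ∉ g' := by
    intro p q hpq hX hng
    have hp : p ≠ w := by rintro rfl; rw [Sym2.eq_swap] at hX; exact hw _ hX
    have hq : q ≠ w := by rintro rfl; exact hw _ hX
    refine ⟨hp, hq, ⟨⟨s(p, q), hX, ?_⟩, ?_⟩, fun h' => hng (hg _ _ h')⟩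
    · rw [Sym2.map_mk, contractFun_of_ne haw hp, contractFun_of_ne haw hq]
    · rw [Sym2.mk_isDiag_iff]
      intro h'
      exact hpq (Subtype.ext_iff.1 h')
  refine ⟨h1.nc, ?_, ?_⟩
  · obtain ⟨p, q, hpq, hX, hng, hpT⟩ := h.ein
    obtain ⟨hp, hq, h2, h3⟩ := key p q hpq hX hng
    exact ⟨⟨p, hp⟩, ⟨q, hq⟩, fun h' => hpq (Subtype.ext_iff.1 h'), h2, h3, hpT⟩
  · obtain ⟨p, q, hpq, hX, hng, hpT⟩ := h.eout
    obtain ⟨hp, hq, h2, h3⟩ := key p q hpq hX hng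
    exact ⟨⟨p, hp⟩, ⟨q, hq⟩, fun h' => hpq (Subtype.ext_iff.1 h'), h2, h3, hpT⟩

/-- Changing `T` at a vertex not covered by `X`. -/
theorem disc_modify {V : Type} {X g : Set (Sym2 V)} {T T' : Set V} {w : V}
    (hw : ∀ b, s(b, w) ∉ X) (h : Disc X g T) (hT : ∀ x, x ≠ w → (x ∈ T' ↔ x ∈ T)) :
    Disc X g T' := by
  have hne : ∀ a b, s(a, b) ∈ X → a ≠ w ∧ b ≠ w := by
    intro a b hab
    constructor
    · rintro rfl; rw [Sym2.eq_swap] at hab; exact hw _ hab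
    · rintro rfl; exact hw _ hab
  refine ⟨?_, ?_, ?_⟩
  · intro a b hab
    rw [hT a (hne a b hab).1, hT b (hne a b hab).2]
    exact h.nc a b hab
  · obtain ⟨p, q, hpq, hX, hng, hpT⟩ := h.ein
    exact ⟨p, q, hpq, hX, hng, (hT p (hne p q hX).1).2 hpT⟩
  · obtain ⟨p, q, hpq, hX, hng, hpT⟩ := h.eout
    exact ⟨p, q, hpq, hX, hng, fun h' => hpT ((hT p (hne p q hX).1).1 h')⟩

theorem exists_modify {V : Type} (T : Set V) (w r : V) (hr : r ≠ w) :
    ∃ T' : Set V, (∀ x, x ≠ w → (x ∈ T' ↔ x ∈ T)) ∧ (r ∈ T' ↔ w ∈ T') := by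
  refine ⟨{x | (x ≠ w ∧ x ∈ T) ∨ (x = w ∧ r ∈ T)}, ?_, ?_⟩
  · intro x hx; simp [hx]
  · simp [hr]

theorem exists_disc {V : Type} {X : Set (Sym2 V)} (h : ¬ EdgeSetConnected X) :
    ∃ T, Disc X ∅ T := by
  unfold EdgeSetConnected at h
  push Not at h
  obtain ⟨u, ⟨u', hu⟩, v, ⟨v', hv⟩, huv⟩ := h
  refine ⟨{x | (fromEdgeSet X).Reachable u x}, ?_, ?_, ?_⟩
  · intro a b hab
    by_cases hne : a = b
    · rw [hne]
    · have : (fromEdgeSet X).Adj a b := by rw [fromEdgeSet_adj]; exact ⟨hab, hne⟩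
      exact ⟨fun h => h.trans this.reachable, fun h => h.trans this.symm.reachable⟩
  · replace hu := (fromEdgeSet_adj _).1 hu
    exact ⟨u, u', hu.2, hu.1, by simp, Reachable.refl _⟩
  · replace hv := (fromEdgeSet_adj _).1 hv
    exact ⟨v, v', hv.2, hv.1, by simp, huv⟩

/-- The main consequence of essentiality for an edge `zw` with `w` not covered by `X`. -/
theorem main_edge (C : CGraph) (h3 : KConnected 3 C.G)
    (hdisc : ¬ EdgeSetConnected C.X) (h5 : 4 < Nat.card C.V)
    (hess : ∀ e ∈ C.G.edgeSet, e ∉ C.X → Essential C e)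
    (z w : C.V) (hzw : C.G.Adj z w) (hw : ∀ b, s(b, w) ∉ C.X) :
    (∃ x A B, z ≠ x ∧ w ≠ x ∧ Sepn C.G {z, w, x} A B) ∧
    ∃ p q, p ≠ q ∧ p ≠ w ∧ q ≠ w ∧ (∀ t, C.G.Adj z t ↔ t = w ∨ t = p ∨ t = q) ∧
      ∀ r, C.G.Adj z r → r ≠ w → ∀ T, (r ∈ T ↔ z ∈ T) → ¬ Disc C.X {s(r, z)} T := by
  have hE := hess s(z, w) hzw (hw z)
  have hns := ((kconn_iff _).1 h3).2
  obtain ⟨T0, hT0⟩ := exists_disc hdisc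
  have hcon : ¬ KConnected 3 (contractGraph C.G hzw.ne) := by
    intro hk
    refine hE.2 z w hzw rfl ⟨_, Relation.ReflTransGen.refl, hk, ?_⟩
    obtain ⟨T', hT1, hT2⟩ := exists_modify T0 w z hzw.ne
    exact (disc_contract_unsupp C.X hzw.ne (g' := ∅) hw (disc_modify hw hT0 hT1) hT2
      (fun p q h => by simp at h)).not_connected
  obtain ⟨x, A, B, hzx, hwx, hsep⟩ := exists_three_sep hns h5 hzw.ne hzw hcon
  refine ⟨⟨x, A, B, hzx, hwx, hsep⟩, ?_⟩
  set H := C.G.deleteEdges {s(z, w)} with hH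
  have hHadj : ∀ a b, H.Adj a b ↔ C.G.Adj a b ∧ s(a, b) ≠ s(z, w) := by
    intro a b; rw [hH, deleteEdges_adj]; simp
  have hgood := good_delete hns hsep hzx hwx
  rw [← hH] at hgood
  -- the general construction of a bad minor
  have build : ∀ (T : Set C.V) (g : Set (Sym2 C.V)), Disc C.X g T →
      (z ∈ lowDeg H → ∃ r c, H.Adj r z ∧ c ≠ w ∧ (∀ t, H.Adj z t → t = r ∨ t = c) ∧
        (r ∈ T ↔ z ∈ T) ∧ g = {s(r, z)}) → False := by
    intro T g hT hz
    apply hE.1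
    by_cases hwD : w ∈ lowDeg H
    · obtain ⟨a, c, hac⟩ := hwD
      -- pick two genuine neighbours
      obtain ⟨a', ha', ha'z, -⟩ := deg_three h3 w z z
      have hHa' : H.Adj a' w := by
        rw [hHadj]
        refine ⟨ha'.symm, ?_⟩
        rw [Ne, Sym2.eq_iff]
        have := hzw.ne
        have := ha'.ne
        tauto
      obtain ⟨c', hc'⟩ : ∃ c', ∀ t, H.Adj w t → t = a' ∨ t = c' := by
        rcases hac _ hHa'.symm with h | h
        · exact ⟨c, fun t ht => h ▸ hac t ht⟩
        · exact ⟨a, fun t ht => h ▸ (hac t ht).symm⟩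
      obtain ⟨T', hT1, hT2⟩ := exists_modify T w a' hHa'.ne
      have hHzw : ¬ H.Adj z w := by rw [hHadj]; simp
      have hHC : (C.deleteEdge s(z, w)).G.Adj a' w := hHa'
      apply BadMinor.of_contract hHC
      have hcw := card_ne w
      obtain ⟨gg, hgg⟩ : ∃ gg : Set (Sym2 {x : C.V // x ≠ w}),
          ∀ e, e ∈ gg ↔ Sym2.map Subtype.val e ∈ g := ⟨{e | Sym2.map Subtype.val e ∈ g}, fun _ => Iff.rfl⟩
      refine badMinor_one ((C.deleteEdge s(z, w)).contract a' w hHa'.ne)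
        {x | x.1 ∈ ({z, w} ∩ lowDeg H : Set C.V)} ⟨z, hzw.ne⟩
        (good_suppress hgood hHa' hc') ?_ ?_ {x | x.1 ∈ T'}
        gg ?_ ?_
      · intro y hy
        rcases hy.1 with h | h
        · exact Subtype.ext h
        · exact absurd h y.2
      · show 3 < Nat.card {x : C.V // x ≠ w}
        omega
      · exact disc_contract_unsupp C.X hHa'.ne hw (disc_modify hw hT hT1) hT2
          (fun p q h => by rw [hgg] at h; exact h)
      · rintro ⟨-, hzD⟩
        replace hzD : z ∈ lowDeg H := hzD
        obtain ⟨r, c, hrz, hcw', hN, hrT, hg⟩ := hz hzD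
        have hrw : r ≠ w := by rintro rfl; exact hHzw hrz.symm
        have hza : z ≠ a' := fun h => ha'z h.symm
        refine ⟨?_, ⟨r, hrw⟩, ⟨c, hcw'⟩, contract_adj_old _ hrz hrw hzw.ne, ?_, ?_, ?_⟩
        · show 4 < Nat.card {x : C.V // x ≠ w}
          -- need six vertices
          obtain ⟨va, hva, hzva⟩ := sep_nbr hns hsep hzw.ne hzx
          obtain ⟨vb, hvb, hzvb⟩ := sep_nbr hns hsep.symm hzw.ne hzx
          have hsep' : Sepn C.G {w, z, x} A B := by rw [Set.insert_comm]; exact hsep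
          obtain ⟨wa, hwa, hwwa⟩ := sep_nbr hns hsep' hzw.ne.symm hwx
          obtain ⟨wb, hwb, hwwb⟩ := sep_nbr hns hsep'.symm hzw.ne.symm hwx
          have hA : ∀ t ∈ A, t ≠ z ∧ t ≠ w ∧ t ≠ x := by
            intro t ht
            refine ⟨?_, ?_, ?_⟩ <;> rintro rfl <;> exact hsep.sp _ (by simp) ht
          have hB : ∀ t ∈ B, t ≠ z ∧ t ≠ w ∧ t ≠ x ∧ t ∉ A := by
            intro t ht
            refine ⟨?_, ?_, ?_, fun h => hsep.pq _ h ht⟩ <;> rintro rfl <;>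
              exact hsep.sq _ (by simp) ht
          have hAB : va ≠ vb ∧ wa ≠ wb := by
            constructor
            · rintro rfl; exact (hB _ hvb).2.2.2 hva
            · rintro rfl; exact (hB _ hwb).2.2.2 hwa
          have q1 : ∀ t, t ≠ z → t ≠ w → C.G.Adj z t → H.Adj z t := by
            intro t h1 h2 h
            rw [hHadj]; refine ⟨h, ?_⟩; rw [Ne, Sym2.eq_iff]; tauto
          have q2 : ∀ t, t ≠ z → t ≠ w → C.G.Adj w t → H.Adj w t := by
            intro t h1 h2 h
            rw [hHadj]; refine ⟨h, ?_⟩; rw [Ne, Sym2.eq_iff]; tauto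
          have m1 := hN _ (q1 va (hA _ hva).1 (hA _ hva).2.1 hzva)
          have m2 := hN _ (q1 vb (hB _ hvb).1 (hB _ hvb).2.1 hzvb)
          have m3 := hc' _ (q2 wa (hA _ hwa).1 (hA _ hwa).2.1 hwwa)
          have m4 := hc' _ (q2 wb (hB _ hwb).1 (hB _ hwb).2.1 hwwb)
          have hxz : ¬ C.G.Adj z x := by
            intro h
            have m := hN _ (q1 x hzx.symm hwx.symm h)
            have := hA _ hva
            have := hB _ hvb
            grind
          have hxw : ¬ C.G.Adj w x := by
            intro h
            have m := hc' _ (q2 x hzx.symm hwx.symm h)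
            have := hA _ hwa
            have := hB _ hwb
            grind
          obtain ⟨t, hxt, htva, htvb⟩ := deg_three h3 x va vb
          have htz : t ≠ z := by rintro rfl; exact hxz hxt.symm
          have htw : t ≠ w := by rintro rfl; exact hxw hxt.symm
          have htx : t ≠ x := hxt.ne.symm
          have six : ({z, w, x, va, vb, t} : Set C.V).ncard = 6 := by
            have := hA _ hva
            have := hB _ hvb
            have := hzw.ne
            rw [Set.ncard_insert_of_notMem (by simp; grind),
              Set.ncard_insert_of_notMem (by simp; grind),
              Set.ncard_insert_of_notMem (by simp; grind),
              Set.ncard_insert_of_notMem (by simp; grind),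
              Set.ncard_insert_of_notMem (by simp; grind), Set.ncard_singleton]
          have hle := Set.ncard_le_ncard (Set.subset_univ ({z, w, x, va, vb, t} : Set C.V))
            (Set.toFinite _)
          rw [six, Set.ncard_univ] at hle
          omega
        · intro t ht
          have := hN _ (contract_adj_rev hHa'.ne hzw.ne hza hHzw ht)
          rcases this with h | h
          · exact Or.inl (Subtype.ext h)
          · exact Or.inr (Subtype.ext h)
        · show r ∈ T' ↔ z ∈ T'
          rw [hT1 r hrw, hT1 z hzw.ne]; exact hrT
        · have : gg = {s((⟨r, hrw⟩ : {x : C.V // x ≠ w}), ⟨z, hzw.ne⟩)} := by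
            ext e
            rw [hgg, hg]
            induction e with
            | _ p q =>
              rw [Sym2.map_mk, Set.mem_singleton_iff, Set.mem_singleton_iff, Sym2.eq_iff,
                Sym2.eq_iff]
              simp only [Subtype.ext_iff]
          exact this
    · refine badMinor_one (C.deleteEdge s(z, w)) ({z, w} ∩ lowDeg H) z hgood ?_ ?_ T g hT ?_
      · rintro y ⟨h | h, hy⟩
        · exact h
        · exact absurd (h ▸ hy) hwD
      · show 3 < Nat.card C.V
        omega
      · rintro ⟨-, hzD⟩
        obtain ⟨r, c, hrz, hcw', hN, hrT, hg⟩ := hz hzD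
        exact ⟨h5, r, c, hrz, hN, hrT, hg⟩
  have hzD : z ∈ lowDeg H := by
    by_contra hzD
    exact build T0 ∅ hT0 (fun h => absurd h hzD)
  obtain ⟨p, q, hpq⟩ := hzD
  have hN : ∀ t, C.G.Adj z t → t ≠ w → t = p ∨ t = q := by
    intro t ht htw
    apply hpq
    rw [hHadj]
    refine ⟨ht, ?_⟩
    rw [Ne, Sym2.eq_iff]
    have := ht.ne
    tauto
  obtain ⟨t1, ht1, ht1w, ht1p⟩ := deg_three h3 z w p
  have e1 : t1 = q := (hN t1 ht1 ht1w).resolve_left ht1p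
  subst e1
  obtain ⟨t2, ht2, ht2w, ht2q⟩ := deg_three h3 z w t1
  have e2 : t2 = p := (hN t2 ht2 ht2w).resolve_right ht2q
  subst e2
  refine ⟨t2, t1, ht2q, ht2w, ht1w, ?_, ?_⟩
  · intro t
    constructor
    · intro ht
      by_cases htw : t = w
      · exact Or.inl htw
      · exact Or.inr (hN t ht htw)
    · rintro (rfl | rfl | rfl)
      · exact hzw
      · exact ht2
      · exact ht1
  · intro r hr hrw T hrT hD
    refine build T _ hD (fun _ => ?_)
    have hHr : H.Adj r z := by
      rw [hHadj]
      refine ⟨hr.symm, ?_⟩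
      rw [Ne, Sym2.eq_iff]
      have := hr.ne
      have := hzw.ne
      tauto
    rcases hN r hr hrw with rfl | rfl
    · exact ⟨r, t1, hHr, ht1w, hpq, hrT, rfl⟩
    · exact ⟨r, t2, hHr, ht2w, fun t ht => (hpq t ht).symm, hrT, rfl⟩

/-- The data of the lemma: `vv'` is a component of `X` and `cd` is another edge of `X`. -/
structure Setup (C : CGraph) (v v' : C.V) : Prop where
  wf : C.WF
  h3 : KConnected 3 C.G
  hdisc : ¬ EdgeSetConnected C.X
  h5 : 4 < Nat.card C.V
  hess : ∀ e ∈ C.G.edgeSet, e ∉ C.X → Essential C e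
  hf : s(v, v') ∈ C.X
  comp : ∀ a b, s(a, b) ∈ C.X → (a = v ∨ a = v') → s(a, b) = s(v, v')
  other : ∃ c d, s(c, d) ∈ C.X ∧ c ≠ v ∧ c ≠ v' ∧ d ≠ v ∧ d ≠ v'

namespace Setup
variable {C : CGraph} {v v' : C.V}

theorem swap (h : Setup C v v') : Setup C v' v where
  wf := h.wf
  h3 := h.h3
  hdisc := h.hdisc
  h5 := h.h5
  hess := h.hess
  hf := by rw [Sym2.eq_swap]; exact h.hf
  comp a b hab h' := by rw [h.comp a b hab h'.symm, Sym2.eq_swap]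
  other := by
    obtain ⟨c, d, h1, h2, h3, h4, h5⟩ := h.other
    exact ⟨c, d, h1, h3, h2, h5, h4⟩

theorem adj (h : Setup C v v') {a b : C.V} (hab : s(a, b) ∈ C.X) : C.G.Adj a b := h.wf hab

theorem noCross (h : Setup C v v') : NoCross C.X {v, v'} := by
  have key : ∀ a b, s(a, b) ∈ C.X → a ∈ ({v, v'} : Set C.V) → b ∈ ({v, v'} : Set C.V) := by
    intro a b hab ha
    have := h.comp a b hab (by simpa using ha)
    rw [Sym2.eq_iff] at this
    simp; tauto
  intro a b hab
  exact ⟨key a b hab, key b a (by rw [Sym2.eq_swap]; exact hab)⟩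

theorem noCross_compl (h : Setup C v v') : NoCross C.X ({v, v'}ᶜ) := by
  intro a b hab
  exact not_congr (h.noCross a b hab)

/-- An edge between uncovered vertices does not exist. -/
theorem uncovered (h : Setup C v v') {z w : C.V} (hzw : C.G.Adj z w) (hw : ∀ b, s(b, w) ∉ C.X) :
    ∃ b, s(z, b) ∈ C.X := by
  by_contra hz
  push Not at hz
  have hz' : ∀ b, s(b, z) ∉ C.X := fun b hb => hz b (by rw [Sym2.eq_swap]; exact hb)
  obtain ⟨-, p, q, hpq, hpw, hqw, hN, hr⟩ := main_edge C h.h3 h.hdisc h.h5 h.hess z w hzw hw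
  obtain ⟨T0, hT0⟩ := exists_disc h.hdisc
  have hzp : C.G.Adj z p := (hN p).2 (by simp)
  obtain ⟨T', hT1, hT2⟩ := exists_modify T0 z p hzp.ne.symm
  have hD := disc_modify hz' hT0 hT1
  refine hr p hzp hpw T' hT2 ⟨hD.nc, ?_, ?_⟩
  · obtain ⟨a, b, h1, h2, h3, h4⟩ := hD.ein
    refine ⟨a, b, h1, h2, fun h' => ?_, h4⟩
    rw [Set.mem_singleton_iff] at h'
    exact hz' p (h' ▸ h2)
  · obtain ⟨a, b, h1, h2, h3, h4⟩ := hD.eout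
    refine ⟨a, b, h1, h2, fun h' => ?_, h4⟩
    rw [Set.mem_singleton_iff] at h'
    rw [h'] at h2
    have hcontra := hz' p
    exact hcontra h2

/-- Neighbourhood of an end of the single-edge component. -/
theorem end_nbr (h : Setup C v v') {w : C.V} (hvw : C.G.Adj v w) (hw : ∀ b, s(b, w) ∉ C.X) :
    ∃ y, y ≠ v ∧ y ≠ v' ∧ y ≠ w ∧ (∀ t, C.G.Adj v t ↔ t = w ∨ t = v' ∨ t = y) ∧
      ∃ b, s(y, b) ∈ C.X := by
  obtain ⟨-, p, q, hpq, hpw, hqw, hN, hr⟩ := main_edge C h.h3 h.hdisc h.h5 h.hess v w hvw hw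
  have hv' : v' ≠ w := by rintro rfl; exact hw _ h.hf
  have hvv' := h.adj h.hf
  obtain ⟨y, hy, hyv', hyw⟩ : ∃ y, (∀ t, C.G.Adj v t ↔ t = w ∨ t = v' ∨ t = y) ∧ y ≠ v' ∧ y ≠ w := by
    rcases (hN v').1 hvv' with h' | rfl | rfl
    · exact absurd h' hv'
    · exact ⟨q, hN, hpq.symm, hqw⟩
    · exact ⟨p, fun t => by rw [hN]; tauto, hpq, hpw⟩
  have hvy : C.G.Adj v y := (hy y).2 (by simp)
  refine ⟨y, hvy.ne.symm, hyv', hyw, hy, ?_⟩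
  by_contra hun
  push Not at hun
  obtain ⟨c, d, hcd, hcv, hcv', hdv, hdv'⟩ := h.other
  refine hr y hvy hyw ({v, v', y} : Set C.V) (by simp) ⟨?_, ?_, ?_⟩
  · intro a b hab
    have h1 := h.noCross a b hab
    have ha : a ≠ y := by rintro rfl; exact hun _ hab
    have hb : b ≠ y := by rintro rfl; rw [Sym2.eq_swap] at hab; exact hun _ hab
    simp at h1 ⊢
    tauto
  · refine ⟨v, v', hvv'.ne, h.hf, ?_, by simp⟩
    rw [Set.mem_singleton_iff, Sym2.eq_iff]
    have := hvy.ne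
    tauto
  · refine ⟨c, d, (h.adj hcd).ne, hcd, ?_, ?_⟩
    · rw [Set.mem_singleton_iff, Sym2.eq_iff]
      tauto
    · have : c ≠ y := by rintro rfl; exact hun _ hcd
      simp; tauto

/-- Neighbours of `w` in the other components. -/
theorem far_nbr (h : Setup C v v') {z w : C.V} (hzw : C.G.Adj z w) (hw : ∀ b, s(b, w) ∉ C.X)
    (hzv : z ≠ v) (hzv' : z ≠ v') :
    ∃ p q, p ≠ q ∧ p ≠ w ∧ q ≠ w ∧ (∀ t, C.G.Adj z t ↔ t = w ∨ t = p ∨ t = q) ∧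
      C.X = {s(v, v'), s(z, p)} ∧ (q = v ∨ q = v') ∧ p ≠ v ∧ p ≠ v' := by
  obtain ⟨b, hb⟩ := h.uncovered hzw hw
  obtain ⟨-, p0, q0, hpq0, hpw0, hqw0, hN0, hr⟩ := main_edge C h.h3 h.hdisc h.h5 h.hess z w hzw hw
  have hvv' := h.adj h.hf
  have hbw : b ≠ w := by rintro rfl; exact hw _ hb
  obtain ⟨p, q, hpq, hpw, hqw, hN, hp⟩ : ∃ p q, p ≠ q ∧ p ≠ w ∧ q ≠ w ∧
      (∀ t, C.G.Adj z t ↔ t = w ∨ t = p ∨ t = q) ∧ s(z, p) ∈ C.X := by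
    rcases (hN0 b).1 (h.adj hb) with h' | rfl | rfl
    · exact absurd h' hbw
    · exact ⟨b, q0, hpq0, hpw0, hqw0, hN0, hb⟩
    · exact ⟨b, p0, hpq0.symm, hqw0, hpw0, fun t => by rw [hN0]; tauto, hb⟩
  have hzp := h.adj hp
  have hnc := h.noCross_compl
  have hpT : p ∈ ({v, v'}ᶜ : Set C.V) := (hnc z p hp).1 (by simp; tauto)
  have hpv : p ≠ v ∧ p ≠ v' := by simpa using hpT
  refine ⟨p, q, hpq, hpw, hqw, hN, ?_, ?_, hpv⟩
  · apply Set.Subset.antisymm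
    · intro e he
      induction e with
      | _ a b =>
        by_contra hc
        simp only [Set.mem_insert_iff, Set.mem_singleton_iff, not_or] at hc
        have haT : a ∈ ({v, v'}ᶜ : Set C.V) := by
          intro ha
          exact hc.1 (h.comp a b he (by simpa using ha))
        refine hr p hzp hpw _ (hnc p z (by rw [Sym2.eq_swap]; exact hp)) ⟨hnc, ?_, ?_⟩
        · refine ⟨a, b, (h.adj he).ne, he, ?_, haT⟩
          rw [Set.mem_singleton_iff, Sym2.eq_swap (a := p)]
          exact hc.2
        · refine ⟨v, v', hvv'.ne, h.hf, ?_, by simp⟩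
          rw [Set.mem_singleton_iff, Sym2.eq_iff]
          tauto
    · rintro e (rfl | rfl)
      · exact h.hf
      · exact hp
  · by_contra hq
    have hzq : C.G.Adj z q := (hN q).2 (by simp)
    refine hr q hzq hqw ({v, v'}ᶜ) (by simp; tauto) ⟨hnc, ?_, ?_⟩
    · refine ⟨z, p, hzp.ne, hp, ?_, by simp; tauto⟩
      rw [Set.mem_singleton_iff, Sym2.eq_iff]
      have := hzp.ne
      tauto
    · refine ⟨v, v', hvv'.ne, h.hf, ?_, by simp⟩
      rw [Set.mem_singleton_iff, Sym2.eq_iff]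
      tauto

/-- Recognising the wheel. -/
theorem wheel (h : Setup C v v') {w y y' : C.V} (hw : ∀ b, s(b, w) ∉ C.X)
    (hyv : y ≠ v) (hyv' : y ≠ v') (hyw : y ≠ w)
    (hy'v : y' ≠ v) (hy'v' : y' ≠ v') (hy'w : y' ≠ w) (hyy' : y ≠ y')
    (hNv : ∀ t, C.G.Adj v t ↔ t = w ∨ t = v' ∨ t = y)
    (hNv' : ∀ t, C.G.Adj v' t ↔ t = w ∨ t = v ∨ t = y')
    (hNy : ∀ t, C.G.Adj y t ↔ t = w ∨ t = y' ∨ t = v)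
    (hX : C.X = {s(v, v'), s(y, y')}) : CGIso C constraintWheel := by
  have hvv' : v ≠ v' := (h.adj h.hf).ne
  have hvw : v ≠ w := ((hNv w).2 (by simp)).ne
  have hv'w : v' ≠ w := ((hNv' w).2 (by simp)).ne
  have hall : ∀ t, t = v' ∨ t = v ∨ t = y ∨ t = y' ∨ t = w := by
    intro t
    by_contra ht
    push Not at ht
    obtain ⟨ht1, ht2, ht3, ht4, ht5⟩ := ht
    have htun : ∀ b, s(b, t) ∉ C.X := by
      intro b hb
      rw [hX] at hb
      simp only [Set.mem_insert_iff, Set.mem_singleton_iff, Sym2.eq_iff] at hb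
      tauto
    obtain ⟨s, hts, hsy', -⟩ := deg_three h.h3 t y' y'
    obtain ⟨b, hb⟩ := h.uncovered hts.symm htun
    rw [hX] at hb
    simp only [Set.mem_insert_iff, Set.mem_singleton_iff, Sym2.eq_iff] at hb
    have h1 := hNv t
    have h2 := hNv' t
    have h3 := hNy t
    have hst := hts.symm
    rcases hb with (⟨rfl, _⟩ | ⟨rfl, _⟩) | (⟨rfl, _⟩ | ⟨rfl, _⟩) <;> tauto
  have hNy' : ∀ t, C.G.Adj y' t ↔ t = w ∨ t = v' ∨ t = y := by
    have hsub : ∀ t, C.G.Adj y' t → t = w ∨ t = v' ∨ t = y := by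
      intro t ht
      have h1 := hall t
      have h2 : t ≠ y' := ht.ne.symm
      have h3 : t ≠ v := by
        rintro rfl
        have := (hNv y').1 ht.symm
        tauto
      tauto
    intro t
    refine ⟨hsub t, ?_⟩
    rintro (rfl | rfl | rfl)
    · obtain ⟨s, hs, h1, h2⟩ := deg_three h.h3 y' v' y
      have := hsub s hs
      have : s = t := by tauto
      exact this ▸ hs
    · exact ((hNv' y').2 (by simp)).symm
    · exact ((hNy y').2 (by simp)).symm
  have hNw : ∀ t, C.G.Adj w t ↔ t ≠ w := by
    intro t
    refine ⟨fun h => h.ne.symm, fun ht => ?_⟩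
    rcases hall t with rfl | rfl | rfl | rfl | rfl
    · exact ((hNv' w).2 (by simp)).symm
    · exact ((hNv w).2 (by simp)).symm
    · exact ((hNy w).2 (by simp)).symm
    · exact ((hNy' w).2 (by simp)).symm
    · exact absurd rfl ht
  let F : Fin 5 → C.V := ![v', v, y, y', w]
  have hinj : Function.Injective F := by
    intro i j hij
    fin_cases i <;> fin_cases j <;> simp [F] at hij ⊢ <;> grind
  have hsurj : Function.Surjective F := by
    intro t
    rcases hall t with rfl | rfl | rfl | rfl | rfl
    · exact ⟨0, rfl⟩
    · exact ⟨1, rfl⟩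
    · exact ⟨2, rfl⟩
    · exact ⟨3, rfl⟩
    · exact ⟨4, rfl⟩
  let E : Fin 5 ≃ C.V := Equiv.ofBijective F ⟨hinj, hsurj⟩
  have hadj : ∀ i j, C.G.Adj (F i) (F j) ↔ wheelGraph.Adj i j := by
    intro i j
    unfold wheelGraph
    rw [fromEdgeSet_adj]
    fin_cases i <;> fin_cases j <;>
      simp [F, hNv, hNv', hNy, hNy', hNw] <;> grind
  let φ : constraintWheel.G ≃g C.G := ⟨E, fun {i j} => hadj i j⟩
  refine ⟨φ.symm, ?_⟩
  have h0 : ∀ i, φ.symm (F i) = i := fun i => φ.symm_apply_apply i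
  have e0 : φ.symm v' = (0 : Fin 5) := h0 0
  have e1 : φ.symm v = (1 : Fin 5) := h0 1
  have e2 : φ.symm y = (2 : Fin 5) := h0 2
  have e3 : φ.symm y' = (3 : Fin 5) := h0 3
  rw [hX, Set.image_pair, Sym2.map_mk, Sym2.map_mk, e0, e1, e2, e3]
  have hfin : ({s(1, 0), s(2, 3)} : Set (Sym2 (Fin 5))) = {s(0, 1), s(2, 3)} := by
    rw [Sym2.eq_swap (a := (1 : Fin 5))]
  exact hfin

theorem final (h : Setup C v v') {w : C.V} (hvw : C.G.Adj v w) (hw : ∀ b, s(b, w) ∉ C.X) :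
    CGIso C constraintWheel := by
  obtain ⟨⟨x, A, B, hvx, hwx, hsep⟩, -⟩ := main_edge C h.h3 h.hdisc h.h5 h.hess v w hvw hw
  have hns := ((kconn_iff _).1 h.h3).2
  have hvv' := h.adj h.hf
  have hv'w : v' ≠ w := by rintro rfl; exact hw _ h.hf
  obtain ⟨y, hyv, hyv', hyw, hNv, b, hyb⟩ := h.end_nbr hvw hw
  -- orient the separation
  have orient : ∃ A B, Sepn C.G {v, w, x} A B ∧ v' ∈ A ∧ y ∈ B := by
    obtain ⟨a, ha, hva⟩ := sep_nbr hns hsep hvw.ne hvx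
    obtain ⟨b, hb, hvb⟩ := sep_nbr hns hsep.symm hvw.ne hvx
    have haw : a ≠ w := by rintro rfl; exact hsep.sp _ (by simp) ha
    have hbw : b ≠ w := by rintro rfl; exact hsep.sq _ (by simp) hb
    have hab : a ≠ b := by rintro rfl; exact hsep.pq _ ha hb
    have h1 := (hNv a).1 hva
    have h2 := (hNv b).1 hvb
    rcases h1 with h1 | rfl | rfl
    · exact absurd h1 haw
    · have : b = y := by tauto
      exact ⟨A, B, hsep, ha, this ▸ hb⟩
    · have : b = v' := by tauto
      exact ⟨B, A, hsep.symm, this ▸ hb, ha⟩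
  clear hsep
  obtain ⟨A, B, hsep, hv'A, hyB⟩ := orient
  have hsep' : Sepn C.G {w, v, x} A B := by rw [Set.insert_comm]; exact hsep
  obtain ⟨a, haA, hwa⟩ := sep_nbr hns hsep' hvw.ne.symm hwx
  have hav : a ≠ v := by rintro rfl; exact hsep.sp _ (by simp) haA
  have hav' : a = v' := by
    by_contra hav'
    obtain ⟨p, q, hpq, hpw, hqw, hN, hX, hq, hpv, hpv'⟩ := h.far_nbr hwa.symm hw hav hav'
    rw [hX] at hyb
    simp only [Set.mem_insert_iff, Set.mem_singleton_iff, Sym2.eq_iff] at hyb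
    have hya : y ≠ a := by rintro rfl; exact hsep.pq _ haA hyB
    have hyp : y = p := by tauto
    exact hsep.na a haA y hyB ((hN y).2 (by tauto))
  subst hav'
  obtain ⟨y', hy'v', hy'v, hy'w, hNv', b', hyb'⟩ := h.swap.end_nbr hwa.symm hw
  have hyy' : y ≠ y' := by
    rintro rfl
    exact hsep.na _ hv'A _ hyB ((hNv' y).2 (by simp))
  obtain ⟨z, hwz, hzv, hzv'⟩ := deg_three h.h3 w v a
  obtain ⟨p, q, hpq, hpw, hqw, hN, hX, hq, hpv, hpv'⟩ := h.far_nbr hwz.symm hw hzv hzv'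
  have hyz : y = z ∨ y = p := by
    rw [hX] at hyb
    simp only [Set.mem_insert_iff, Set.mem_singleton_iff, Sym2.eq_iff] at hyb
    tauto
  have hyz' : y' = z ∨ y' = p := by
    rw [hX] at hyb'
    simp only [Set.mem_insert_iff, Set.mem_singleton_iff, Sym2.eq_iff] at hyb'
    tauto
  rcases hyz with rfl | rfl
  · have hy'p : y' = p := by tauto
    subst hy'p
    have hvy := (hN v).1 ((hNv y).2 (by simp)).symm
    have hqv : v = q := by
      have := hvw.ne
      tauto
    subst hqv
    exact h.wheel hw hyv hyv' hyw hy'v hy'v' hy'w hyy' hNv hNv' hN hX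
  · have hy'z : y' = z := by tauto
    subst hy'z
    have hvy := (hN a).1 ((hNv' y').2 (by simp)).symm
    have hqv : a = q := by
      tauto
    subst hqv
    refine h.swap.wheel hw hy'v' hy'v hy'w hyv' hyv hyw hyy'.symm hNv' hNv hN ?_
    rw [hX, Sym2.eq_swap (a := v)]

end Setup

/-- **Lemma (situation2).** If `X` is disconnected, every edge not in `X` is essential, some
component of `G[X]` is a single edge `f`, and there is an edge `vw` with `v ∈ f` and `w`
outside `G[X]`, then `(G, X)` is the constraint wheel. -/
theorem single_edge_component_wheel (C : CGraph) (hWF : C.WF) (h3 : KConnected 3 C.G)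
    (hdisc : ¬ EdgeSetConnected C.X)
    (hess : ∀ e ∈ C.G.edgeSet, e ∉ C.X → Essential C e)
    (f : Sym2 C.V) (hf : SingleEdgeComponent C.X f)
    (v w : C.V) (hvw : C.G.Adj v w) (hv : v ∈ f)
    (hw : w ∉ (fromEdgeSet C.X).support) :
    CGIso C constraintWheel := by
  
  have hwun : ∀ b, s(b, w) ∉ C.X := by
    intro b hb
    have hadj : C.G.Adj b w := hWF hb
    exact hw ⟨b, (fromEdgeSet_adj _).2 ⟨by rw [Sym2.eq_swap]; exact hb, hadj.ne.symm⟩⟩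
  obtain ⟨v', rfl⟩ := hv
  have hvv' : C.G.Adj v v' := hWF hf.1
  have comp : ∀ a b, s(a, b) ∈ C.X → (a = v ∨ a = v') → s(a, b) = s(v, v') := by
    intro a b hab ha
    exact hf.2 _ hab ⟨a, by simpa using ha, a, by simp, Reachable.refl _⟩
  have other : ∃ c d, s(c, d) ∈ C.X ∧ c ≠ v ∧ c ≠ v' ∧ d ≠ v ∧ d ≠ v' := by
    obtain ⟨T, hT⟩ := exists_disc hdisc
    have : ∃ c d, s(c, d) ∈ C.X ∧ s(c, d) ≠ s(v, v') := by
      by_contra hc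
      push Not at hc
      obtain ⟨a, b, hab, habX, -, haT⟩ := hT.ein
      obtain ⟨c, d, hcd, hcdX, -, hcT⟩ := hT.eout
      have h1 := hc a b habX
      have h2 := hc c d hcdX
      have h3 := hT.nc a b habX
      have h4 := hT.nc c d hcdX
      rw [Sym2.eq_iff] at h1 h2
      grind
    obtain ⟨c, d, hcd, hne⟩ := this
    have h1 := comp c d hcd
    have h2 := comp d c (by rw [Sym2.eq_swap]; exact hcd)
    rw [Sym2.eq_swap (a := d)] at h2
    exact ⟨c, d, hcd, by tauto, by tauto, by tauto, by tauto⟩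
  have h5 : 4 < Nat.card C.V := by
    obtain ⟨c, d, hcd, hcv, hcv', hdv, hdv'⟩ := other
    have hcd' : C.G.Adj c d := hWF hcd
    have hcw : c ≠ w := by rintro rfl; rw [Sym2.eq_swap] at hcd; exact hwun _ hcd
    have hdw : d ≠ w := by rintro rfl; exact hwun _ hcd
    have hv'w : v' ≠ w := by rintro rfl; exact hwun _ hf.1
    have five : ({v, v', c, d, w} : Set C.V).ncard = 5 := by
      have := hvw.ne
      have := hvv'.ne
      have := hcd'.ne
      rw [Set.ncard_insert_of_notMem (by simp; grind),
        Set.ncard_insert_of_notMem (by simp; grind),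
        Set.ncard_insert_of_notMem (by simp; grind),
        Set.ncard_insert_of_notMem (by simp; grind), Set.ncard_singleton]
    have hle := Set.ncard_le_ncard (Set.subset_univ ({v, v', c, d, w} : Set C.V))
      (Set.toFinite _)
    rw [five, Set.ncard_univ] at hle
    omega
  exact Setup.final ⟨hWF, h3, hdisc, h5, hess, hf.1, comp, other⟩ hvw hwun
end
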